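/- Let Ω ⊂ ℝ² be a bounded open set with Lipschitz boundary and let R > 0 be such that |Ω| = πR². Let a : [0,∞) → [0,∞) be a function such that (i) a is nondecreasing and (ii) the map z ↦ (a(√z) − a(0))·√z is convex on [0,∞). Then ∫_{∂Ω} a(|x|) dσ(x) ≥ ∫_{∂B_R(0)} a(|x|) dσ(x) = 2πR·a(R). -/

import Mathlib

open MeasureTheory Metric Real

/-- `Ω ⊂ ℝ²` has Lipschitz boundary: its topological boundary is a finite union
of images of Lipschitz curves. -/
def HasLipschitzBoundary (Ω : Set (EuclideanSpace ℝ (Fin 2))) : Prop :=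
  ∃ (n : ℕ) (γ : Fin n → ℝ → EuclideanSpace ℝ (Fin 2)) (K : Fin n → NNReal),
    (∀ i, LipschitzWith (K i) (γ i)) ∧ frontier Ω = ⋃ i, γ i '' Set.Icc (0 : ℝ) 1


lemma bbmp_const_on {U V : Set ℝ} (hU : IsOpen U) (hV : IsPreconnected V)
    (hd : ∀ x ∈ V, x ∉ frontier U) : V ⊆ U ∨ Disjoint V U := by
  by_cases h : (V ∩ U).Nonempty
  · left
    refine hV.subset_of_closure_inter_subset hU h ?_
    rintro x ⟨hx1, hx2⟩
    by_contra hxU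
    exact hd x hx2 (by rw [hU.frontier_eq]; exact ⟨hx1, hxU⟩)
  · right
    rw [Set.not_nonempty_iff_eq_empty] at h
    exact Set.disjoint_iff_inter_eq_empty.2 h

lemma bbmp_one_d (f : ℝ → ℝ) (hf : ContDiff ℝ 1 f) (h0 : ∀ x, 0 ≤ f x) (F : Finset ℝ) :
    ∀ U : Set ℝ, IsOpen U → Bornology.IsBounded U → frontier U ⊆ F →
      ∫ x in U, deriv f x ≤ ∑ x ∈ F, f x := by
  have hfc : Continuous (deriv f) := hf.continuous_deriv le_rfl
  induction F using Finset.induction_on_max with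
  | empty =>
    intro U hU hb hF
    have : U = ∅ := by
      by_contra hne
      have h1 : U ≠ Set.univ := by
        rintro rfl
        exact NoncompactSpace.noncompact_univ (X := ℝ)
          (isCompact_of_isClosed_isBounded isClosed_univ hb)
      have := nonempty_frontier_iff.2 ⟨Set.nonempty_iff_ne_empty.2 hne, h1⟩
      obtain ⟨x, hx⟩ := this
      simpa using hF hx
    simp [this]
  | insert s F' hlt ih =>
    intro U hU hb hF
    have hs : s ∉ F' := fun h => lt_irrefl _ (hlt s h)
    rw [Finset.sum_insert hs]
    obtain ⟨A, B, hAB⟩ : ∃ A B, U ⊆ Set.Icc A B := by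
      obtain ⟨A, hA⟩ := hb.bddBelow
      obtain ⟨B, hB⟩ := hb.bddAbove
      exact ⟨A, B, fun x hx => ⟨hA hx, hB hx⟩⟩
    have hUs : U ⊆ Set.Iio s := by
      have h1 : Disjoint (Set.Ioi s) U := by
        rcases bbmp_const_on hU (V := Set.Ioi s) isPreconnected_Ioi (by
          intro x hx hxf
          have := hF hxf
          simp only [Finset.coe_insert, Set.mem_insert_iff, Finset.mem_coe] at this
          rcases this with rfl | h
          · exact lt_irrefl _ (Set.mem_Ioi.1 hx)
          · exact lt_asymm (Set.mem_Ioi.1 hx) (hlt x h)) with h | h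
        · exfalso
          have hx : max (s + 1) (B + 1) ∈ Set.Ioi s :=
            Set.mem_Ioi.2 (lt_of_lt_of_le (lt_add_one s) (le_max_left _ _))
          have := (hAB (h hx)).2
          have := le_max_right (s + 1) (B + 1)
          linarith
        · exact h
      intro x hx
      by_contra hxs
      simp only [Set.mem_Iio, not_lt] at hxs
      obtain ⟨y, hy1, hy2⟩ : ∃ y ∈ U, s < y := by
        obtain ⟨ε, hε, hball⟩ := Metric.isOpen_iff.1 hU x hx
        refine ⟨x + ε / 2, hball ?_, by linarith⟩
        rw [Metric.mem_ball, Real.dist_eq]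
        rw [abs_of_pos] <;> linarith
      exact Set.disjoint_left.1 h1 hy2 hy1
    obtain ⟨s', hs's, hFs', hfr⟩ : ∃ s' < s, (∀ x ∈ F', x ≤ s') ∧
        frontier (U ∩ Set.Iio s') ⊆ F' := by
      by_cases hne : F'.Nonempty
      · refine ⟨F'.max' hne, hlt _ (F'.max'_mem hne), fun x hx => F'.le_max' x hx, ?_⟩
        intro x hx
        have h1 := frontier_inter_subset _ _ hx
        have h2 : x ∈ closure (Set.Iio (F'.max' hne)) :=
          closure_mono Set.inter_subset_right (frontier_subset_closure hx)
        rw [closure_Iio] at h2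
        rcases h1 with h1 | h1
        · have := hF h1.1
          simp only [Finset.coe_insert, Set.mem_insert_iff, Finset.mem_coe] at this
          rcases this with rfl | h
          · exact absurd h2 (not_le.2 (hlt _ (F'.max'_mem hne)))
          · exact h
        · have := h1.2
          rw [frontier_Iio] at this
          rw [Set.mem_singleton_iff] at this
          rw [this]; exact F'.max'_mem hne
      · rw [Finset.not_nonempty_iff_eq_empty] at hne
        subst hne
        refine ⟨min (s - 1) (A - 1), lt_of_le_of_lt (min_le_left _ _) (by linarith), by simp, ?_⟩
        have : U ∩ Set.Iio (min (s - 1) (A - 1)) = ∅ := by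
          ext x
          simp only [Set.mem_inter_iff, Set.mem_Iio, Set.mem_empty_iff_false, iff_false, not_and]
          intro hx hx2
          have := (hAB hx).1
          have := min_le_right (s - 1) (A - 1)
          linarith
        rw [this]; simp
    have hI := ih (U ∩ Set.Iio s') (hU.inter isOpen_Iio) (hb.subset Set.inter_subset_left) hfr
    have hIntg : IntegrableOn (deriv f) (Set.Icc A B) := hfc.continuousOn.integrableOn_compact isCompact_Icc
    have hsplit : ∫ x in U, deriv f x
        = (∫ x in U ∩ Set.Iio s', deriv f x) + ∫ x in U ∩ Set.Ioo s' s, deriv f x := by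
      have h1 := (integral_inter_add_sdiff (f := deriv f) (μ := volume) (s := U) (t := Set.Iio s') measurableSet_Iio
        (hIntg.mono_set hAB)).symm
      rw [h1]
      congr 1
      apply setIntegral_congr_set
      have : (U ∩ Set.Ioo s' s : Set ℝ) =ᵐ[volume] (U ∩ Set.Ico s' s : Set ℝ) :=
        (ae_eq_refl U).inter Ioo_ae_eq_Ico
      have h2 : (U \ Set.Iio s' : Set ℝ) = U ∩ Set.Ico s' s := by
       ext x
       simp only [Set.mem_sdiff, Set.mem_Iio, not_lt, Set.mem_inter_iff, Set.mem_Ico]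
       constructor
       · rintro ⟨h1, h2⟩; exact ⟨h1, h2, hUs h1⟩
       · rintro ⟨h1, h2, -⟩; exact ⟨h1, h2⟩
      rw [h2]
      exact this.symm
    have hlast : ∫ x in U ∩ Set.Ioo s' s, deriv f x ≤ f s := by
      rcases bbmp_const_on hU (V := Set.Ioo s' s) isPreconnected_Ioo (by
          intro x hx hxf
          have := hF hxf
          simp only [Finset.coe_insert, Set.mem_insert_iff, Finset.mem_coe] at this
          rcases this with rfl | h
          · exact lt_irrefl _ hx.2
          · exact absurd (hFs' x h) (not_le.2 hx.1)) with h | h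
      · rw [Set.inter_eq_right.2 h, ← integral_Ioc_eq_integral_Ioo,
          ← intervalIntegral.integral_of_le hs's.le,
          intervalIntegral.integral_deriv_eq_sub (fun x _ => (hf.differentiable one_ne_zero) x)
            (hfc.intervalIntegrable _ _)]
        linarith [h0 s']
      · rw [Set.inter_comm, Set.disjoint_iff_inter_eq_empty.1 h]
        simpa using h0 s
    rw [hsplit]; linarith

lemma bbmp_one_d' (f : ℝ → ℝ) (hf : ContDiff ℝ 1 f) {δ : ℝ} (hδ : 0 < δ) (h0 : ∀ x, δ ≤ f x) 
    (U : Set ℝ) (hU : IsOpen U) (hb : Bornology.IsBounded U) :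
    ∃ F : Finset ℝ, (F : Set ℝ) ⊆ frontier U ∧ 
      ∫ x in U, deriv f x ≤ ∑ x ∈ F, f x := by
  by_cases h : (frontier U).Finite
  · refine ⟨h.toFinset, by simp, bbmp_one_d f hf (fun x => hδ.le.trans (h0 x)) _ U hU hb (by simp)⟩
  · obtain ⟨N, hN⟩ := exists_nat_ge ((∫ x in U, deriv f x) / δ)
    obtain ⟨F, hF, hc⟩ := Set.Infinite.exists_subset_card_eq h N
    refine ⟨F, hF, ?_⟩
    have : ∑ x ∈ F, f x ≥ ∑ x ∈ F, δ := Finset.sum_le_sum fun x _ => h0 x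
    rw [div_le_iff₀ hδ] at hN
    simp [hc] at this
    linarith


lemma bbmp_psi_mp (b : OrthonormalBasis (Fin 2) ℝ (EuclideanSpace ℝ (Fin 2))) :
    MeasurePreserving (fun p : ℝ × ℝ => p.1 • b 0 + p.2 • b 1) volume volume ∧ 
    MeasurableEmbedding (fun p : ℝ × ℝ => p.1 • b 0 + p.2 • b 1) := by
  have h1 := (volume_preserving_finTwoArrow ℝ).symm
  have h2 := (EuclideanSpace.volume_preserving_symm_measurableEquiv_toLp (Fin 2)).symm
  have h3 := b.measurePreserving_measurableEquiv.symm
  have h := h3.comp (h2.comp h1)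
  have he : (fun p : ℝ × ℝ => p.1 • b 0 + p.2 • b 1) = 
      (MeasurableEquiv.finTwoArrow.symm.trans ((MeasurableEquiv.toLp 2 (Fin 2 → ℝ)).trans b.measurableEquiv.symm)) := by
    funext p
    have : ∀ q : EuclideanSpace ℝ (Fin 2), b.measurableEquiv.symm q = b.repr.symm q := fun q => rfl
    simp [this, MeasurableEquiv.finTwoArrow,
      ← b.sum_repr_symm]
  rw [he]
  exact ⟨h, MeasurableEquiv.measurableEmbedding _⟩

lemma bbmp_onb (v : EuclideanSpace ℝ (Fin 2)) (hv : ‖v‖ = 1) :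
    ∃ b : OrthonormalBasis (Fin 2) ℝ (EuclideanSpace ℝ (Fin 2)), b 1 = v := by
  obtain ⟨b, hb⟩ := Orthonormal.exists_orthonormalBasis_extension_of_card_eq (𝕜 := ℝ)
    (E := EuclideanSpace ℝ (Fin 2)) (ι := Fin 2) (by simp) (v := fun _ => v) (s := {1}) (by
      refine ⟨fun i => hv, fun i j hij => ?_⟩
      exact absurd (Subsingleton.elim i j) hij)
  exact ⟨b, hb 1 rfl⟩


lemma bbmp_coarea (b : OrthonormalBasis (Fin 2) ℝ (EuclideanSpace ℝ (Fin 2)))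
    (E : Set (EuclideanSpace ℝ (Fin 2))) (hE : MeasurableSet E)
    (φ : EuclideanSpace ℝ (Fin 2) → ℝ) (hφ : Continuous φ)
    (G : ℝ → ℝ)
    (hG : ∀ t, ∃ S : Finset ℝ, (∀ s ∈ S, t • b 0 + s • b 1 ∈ E) ∧
      G t ≤ ∑ s ∈ S, φ (t • b 0 + s • b 1)) :
    ∫⁻ t, ENNReal.ofReal (G t) ≤ ∫⁻ x in E, ENNReal.ofReal (φ x) ∂μH[1] := by
  classical
  set p : EuclideanSpace ℝ (Fin 2) → ℝ := fun x => inner ℝ (b 0) x with hp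
  set q : EuclideanSpace ℝ (Fin 2) → ℝ := fun x => inner ℝ (b 1) x with hq
  have hpΨ : ∀ t s : ℝ, p (t • b 0 + s • b 1) = t := by
    intro t s
    simp [hp, inner_add_right, inner_smul_right, b.inner_eq_ite]
  have hqΨ : ∀ t s : ℝ, q (t • b 0 + s • b 1) = s := by
    intro t s
    simp [hq, inner_add_right, inner_smul_right, b.inner_eq_ite]
  have hpc : Continuous p := by fun_prop
  have hqc : Continuous q := by fun_prop
  have hdist : ∀ x y, dist x y ≤ |p x - p y| + |q x - q y| := by
    intro x y
    have h1 : x - y = (p x - p y) • b 0 + (q x - q y) • b 1 := by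
      have := b.sum_repr' (x - y)
      rw [Fin.sum_univ_two] at this
      rw [← this]
      simp [hp, hq, inner_sub_right]
    rw [dist_eq_norm, h1]
    refine (norm_add_le _ _).trans ?_
    simp [norm_smul]
  have hpl : LipschitzWith 1 p := by
    refine LipschitzWith.of_dist_le_mul fun x y => ?_
    rw [Real.dist_eq, dist_eq_norm]
    have : p x - p y = inner ℝ (b 0) (x - y) := by simp [hp, inner_sub_right]
    rw [this]
    refine (abs_real_inner_le_norm _ _).trans ?_
    simp
  let idx : ℕ → EuclideanSpace ℝ (Fin 2) → ℤ × ℤ := fun n x =>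
    (⌊((n : ℝ) + 1) * p x⌋, ⌊((n : ℝ) + 1) * q x⌋)
  have hidx : ∀ n, Measurable (idx n) := by
    intro n
    exact (Int.measurable_floor.comp (hpc.measurable.const_mul _)).prodMk
      (Int.measurable_floor.comp (hqc.measurable.const_mul _))
  let En : ℕ → ℤ × ℤ → Set (EuclideanSpace ℝ (Fin 2)) := fun n k => E ∩ idx n ⁻¹' {k}
  have hEn : ∀ n k, MeasurableSet (En n k) := fun n k =>
    hE.inter ((hidx n) (measurableSet_singleton k))
  let c : ℕ → ℤ × ℤ → ENNReal := fun n k => ⨅ x ∈ En n k, ENNReal.ofReal (φ x)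
  let h : ℕ → ℝ → ENNReal := fun n t =>
    ∑' k, (toMeasurable volume (p '' En n k)).indicator (fun _ => c n k) t
  have hmeas : ∀ n, Measurable (h n) := fun n =>
    Measurable.ennreal_tsum fun k => measurable_const.indicator (measurableSet_toMeasurable _ _)
  have hIntg : ∀ n, ∫⁻ t, h n t ≤ ∫⁻ x in E, ENNReal.ofReal (φ x) ∂μH[1] := by
    intro n
    have h1 : ∫⁻ t, h n t = ∑' k, c n k * volume (p '' En n k) := by
      simp only [h]
      rw [lintegral_tsum fun k => (measurable_const.indicator (measurableSet_toMeasurable _ _)).aemeasurable]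
      congr 1; funext k
      rw [lintegral_indicator (measurableSet_toMeasurable _ _), setLIntegral_const, measure_toMeasurable]
    have h2 : E = ⋃ k, En n k := by
      ext x; simp [En]
    have h3 : ∫⁻ x in E, ENNReal.ofReal (φ x) ∂μH[1]
        = ∑' k, ∫⁻ x in En n k, ENNReal.ofReal (φ x) ∂μH[1] := by
      conv_lhs => rw [h2]
      rw [lintegral_iUnion (hEn n)]
      intro k l hkl
      refine Set.disjoint_left.2 fun x hx hy => hkl ?_
      exact hx.2.symm.trans hy.2
    rw [h1, h3]
    refine ENNReal.tsum_le_tsum fun k => ?_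
    have h4 : volume (p '' En n k) ≤ μH[1] (En n k) := by
      rw [← hausdorffMeasure_real]
      have := hpl.hausdorffMeasure_image_le (d := 1) zero_le_one (En n k)
      simpa using this
    calc c n k * volume (p '' En n k) ≤ c n k * μH[1] (En n k) := by gcongr
      _ = ∫⁻ x in En n k, c n k ∂μH[1] := by rw [setLIntegral_const]
      _ ≤ _ := setLIntegral_mono' (hEn n k) fun x hx => iInf₂_le x hx
  have hpt : ∀ t, ENNReal.ofReal (G t) ≤ Filter.liminf (fun n => h n t) Filter.atTop := by
    intro t
    obtain ⟨S, hSE, hSG⟩ := hG t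
    let P : ℝ → EuclideanSpace ℝ (Fin 2) := fun s => t • b 0 + s • b 1
    have hlow : ∀ ε : ℝ, 0 < ε → ENNReal.ofReal (∑ s ∈ S, (φ (P s) - ε)) ≤
        Filter.liminf (fun n => h n t) Filter.atTop := by
      intro ε hε
      refine Filter.le_liminf_of_le (by isBoundedDefault) ?_
      have e1 : ∀ᶠ n : ℕ in Filter.atTop, ∀ s ∈ S, ∀ s' ∈ S, s ≠ s' → 1 ≤ ((n : ℝ) + 1) * |s - s'| := by
        rw [Filter.eventually_all_finset]
        intro s _
        rw [Filter.eventually_all_finset]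
        intro s' _
        by_cases hss : s = s'
        · simp [hss]
        · have hpos : 0 < |s - s'| := abs_pos.2 (sub_ne_zero.2 hss)
          obtain ⟨N, hN⟩ := exists_nat_ge (1 / |s - s'|)
          filter_upwards [Filter.eventually_ge_atTop N] with n hn _
          rw [div_le_iff₀ hpos] at hN
          have : (N : ℝ) ≤ n := by exact_mod_cast hn
          nlinarith
      have e2 : ∀ᶠ n : ℕ in Filter.atTop, ∀ s ∈ S, ∀ x, dist x (P s) ≤ 2 / ((n : ℝ) + 1) →
          φ (P s) - ε ≤ φ x := by
        rw [Filter.eventually_all_finset]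
        intro s _
        obtain ⟨r, hr, hr2⟩ := Metric.continuous_iff.1 hφ (P s) ε hε
        obtain ⟨N, hN⟩ := exists_nat_gt (2 / r)
        filter_upwards [Filter.eventually_ge_atTop N] with n hn x hx
        have h1 : dist x (P s) < r := by
          refine lt_of_le_of_lt hx ?_
          rw [div_lt_iff₀ hr] at hN
          have : (N : ℝ) ≤ n := by exact_mod_cast hn
          rw [div_lt_iff₀ (by positivity)]
          nlinarith
        have := hr2 x h1
        rw [Real.dist_eq, abs_lt] at this
        linarith
      filter_upwards [e1, e2] with n h1 h2
      have hinj : Set.InjOn (fun s => idx n (P s)) S := by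
        intro s hs s' hs' hss
        by_contra hne
        have h3 := h1 s hs s' hs' hne
        have h4 : ⌊((n : ℝ) + 1) * s⌋ = ⌊((n : ℝ) + 1) * s'⌋ := by
          have := congrArg Prod.snd hss
          simpa [idx, P, hqΨ] using this
        have h5 := Int.abs_sub_lt_one_of_floor_eq_floor h4
        rw [← mul_sub, abs_mul, abs_of_pos (by positivity : (0 : ℝ) < (n : ℝ) + 1)] at h5
        linarith
      calc ENNReal.ofReal (∑ s ∈ S, (φ (P s) - ε)) 
          ≤ ∑ s ∈ S, ENNReal.ofReal (φ (P s) - ε) :=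
            Finset.le_sum_of_subadditive _ ENNReal.ofReal_zero.le (fun _ _ => ENNReal.ofReal_add_le) _ _
        _ ≤ ∑ s ∈ S, (toMeasurable volume (p '' En n (idx n (P s)))).indicator
              (fun _ => c n (idx n (P s))) t := by
            refine Finset.sum_le_sum fun s hs => ?_
            have hmem : P s ∈ En n (idx n (P s)) := ⟨hSE s hs, rfl⟩
            have ht : t ∈ toMeasurable volume (p '' En n (idx n (P s))) :=
              subset_toMeasurable _ _ ⟨P s, hmem, hpΨ t s⟩
            rw [Set.indicator_of_mem ht]
            refine le_iInf₂ fun x hx => ENNReal.ofReal_le_ofReal (h2 s hs x ?_)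
            have h3 : idx n x = idx n (P s) := hx.2
            have h4 := Int.abs_sub_lt_one_of_floor_eq_floor (congrArg Prod.fst h3)
            have h5 := Int.abs_sub_lt_one_of_floor_eq_floor (congrArg Prod.snd h3)
            have hn : (0 : ℝ) < (n : ℝ) + 1 := by positivity
            rw [← mul_sub, abs_mul, abs_of_pos hn] at h4 h5
            refine (hdist x (P s)).trans ?_
            rw [le_div_iff₀ hn]
            nlinarith
        _ = ∑ k ∈ S.image (fun s => idx n (P s)), (toMeasurable volume (p '' En n k)).indicator
              (fun _ => c n k) t := by
            rw [Finset.sum_image hinj]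
        _ ≤ h n t := ENNReal.sum_le_tsum _
    refine (ENNReal.ofReal_le_ofReal hSG).trans ?_
    refine ENNReal.le_of_forall_pos_le_add fun ε hε _ => ?_
    have hcard : (0 : ℝ) < (S.card : ℝ) + 1 := by positivity
    have := hlow (ε / (S.card + 1)) (div_pos (by exact_mod_cast hε) hcard)
    refine le_trans ?_ (add_le_add_left this (ε : ENNReal))
    rw [← ENNReal.ofReal_coe_nnreal, ]
    refine le_trans ?_ ENNReal.ofReal_add_le
    apply ENNReal.ofReal_le_ofReal
    rw [Finset.sum_sub_distrib]
    simp only [Finset.sum_const, nsmul_eq_mul, P]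
    have : (S.card : ℝ) * ((ε : ℝ) / (S.card + 1)) ≤ ε := by
      rw [mul_div_assoc', div_le_iff₀ hcard]
      nlinarith [ε.coe_nonneg]
    linarith
  calc ∫⁻ t, ENNReal.ofReal (G t) ≤ ∫⁻ t, Filter.liminf (fun n => h n t) Filter.atTop := lintegral_mono hpt
    _ ≤ Filter.liminf (fun n => ∫⁻ t, h n t) Filter.atTop := lintegral_liminf_le hmeas
    _ ≤ Filter.liminf (fun _ : ℕ => ∫⁻ x in E, ENNReal.ofReal (φ x) ∂μH[1]) Filter.atTop :=
        Filter.liminf_le_liminf (Filter.Eventually.of_forall hIntg)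
    _ = _ := by simp


lemma bbmp_slice_pos (Ω : Set (EuclideanSpace ℝ (Fin 2))) (hopen : IsOpen Ω)
    (hbdd : Bornology.IsBounded Ω) (hH : μH[1] (frontier Ω) ≠ ⊤)
    (φ : EuclideanSpace ℝ (Fin 2) → ℝ) (hφ : ContDiff ℝ 1 φ) {δ : ℝ} (hδ : 0 < δ)
    (h0 : ∀ x, δ ≤ φ x) (b : OrthonormalBasis (Fin 2) ℝ (EuclideanSpace ℝ (Fin 2))) :
    ∫ x in Ω, fderiv ℝ φ x (b 1) ≤ ∫ x in frontier Ω, φ x ∂μH[1] := by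
  obtain ⟨hmp, hemb⟩ := bbmp_psi_mp b
  set Ψ : ℝ × ℝ → EuclideanSpace ℝ (Fin 2) := fun p => p.1 • b 0 + p.2 • b 1 with hΨ
  have hΨc : Continuous Ψ := by fun_prop
  have hgc : Continuous (fun x => fderiv ℝ φ x (b 1)) :=
    (hφ.continuous_fderiv one_ne_zero).clm_apply continuous_const
  have hIntg : IntegrableOn (fun x => fderiv ℝ φ x (b 1)) Ω :=
    (hgc.continuousOn.integrableOn_compact hbdd.isCompact_closure).mono_set subset_closure
  have hIntg2 : Integrable ((Ψ ⁻¹' Ω).indicator fun p => fderiv ℝ φ (Ψ p) (b 1)) (volume.prod volume) := by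
    rw [← Measure.volume_eq_prod, integrable_indicator_iff (hΨc.measurable hopen.measurableSet)]
    exact (hmp.integrableOn_comp_preimage hemb).2 hIntg
  have hEq : ∫ x in Ω, fderiv ℝ φ x (b 1) =
      ∫ t, ∫ s, (Ψ ⁻¹' Ω).indicator (fun p => fderiv ℝ φ (Ψ p) (b 1)) (t, s) := by
    rw [← hmp.setIntegral_preimage_emb hemb, ← integral_indicator (hΨc.measurable hopen.measurableSet),
      Measure.volume_eq_prod, integral_prod _ hIntg2]
  have hfi : IntegrableOn φ (frontier Ω) μH[1] := by
    have hc : IsCompact (frontier Ω) := isCompact_of_isClosed_isBounded isClosed_frontier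
      (hbdd.closure.subset frontier_subset_closure)
    obtain ⟨C, hC⟩ := hc.exists_bound_of_continuousOn hφ.continuous.continuousOn
    refine IntegrableOn.of_bound (lt_top_iff_ne_top.2 hH) hφ.continuous.aestronglyMeasurable C ?_
    exact (ae_restrict_iff' isClosed_frontier.measurableSet).2 (Filter.Eventually.of_forall hC)
  have hφ0 : ∀ x, 0 ≤ φ x := fun x => hδ.le.trans (h0 x)
  have key := bbmp_coarea b (frontier Ω) isClosed_frontier.measurableSet φ hφ.continuous
    (fun t => ∫ s, (Ψ ⁻¹' Ω).indicator (fun p => fderiv ℝ φ (Ψ p) (b 1)) (t, s)) (by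
      intro t
      have hcs : Continuous (fun s : ℝ => Ψ (t, s)) := by fun_prop
      have hiso : Isometry (fun s : ℝ => Ψ (t, s)) := by
        refine Isometry.of_dist_eq fun s s' => ?_
        simp only [hΨ, dist_add_left]
        rw [dist_eq_norm, ← sub_smul, norm_smul, Real.dist_eq]
        simp
      set U : Set ℝ := (fun s : ℝ => Ψ (t, s)) ⁻¹' Ω with hU
      obtain ⟨S, hS1, hS2⟩ := bbmp_one_d' (fun s => φ (Ψ (t, s)))
        (hφ.comp (by simp only [hΨ]; fun_prop)) hδ (fun s => h0 _) U (hopen.preimage hcs)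
        (hiso.antilipschitz.isBounded_preimage hbdd)
      refine ⟨S, fun s hs => ?_, ?_⟩
      · exact hcs.frontier_preimage_subset Ω (hS1 hs)
      · refine le_trans (le_of_eq ?_) hS2
        rw [← integral_indicator (hcs.measurable hopen.measurableSet)]
        congr 1
        funext s
        have hd : deriv (fun s => φ (Ψ (t, s))) s = fderiv ℝ φ (Ψ (t, s)) (b 1) := by
          have h1 : HasDerivAt (fun s : ℝ => Ψ (t, s)) (b 1) s := by
            have := ((hasDerivAt_id s).smul_const (b 1)).const_add (t • b 0)
            rw [one_smul] at this
            exact this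
          exact (((hφ.differentiable one_ne_zero) _).hasFDerivAt.comp_hasDerivAt s h1).deriv
        by_cases hs : Ψ (t, s) ∈ Ω
        · rw [Set.indicator_of_mem (by exact hs), Set.indicator_of_mem (by exact hs), hd]
        · rw [Set.indicator_of_notMem (by exact hs), Set.indicator_of_notMem (by exact hs)])
  rw [← ofReal_integral_eq_lintegral_ofReal hfi (Filter.Eventually.of_forall hφ0)] at key
  rw [hEq]
  have hGi := hIntg2.integral_prod_left
  have h1 : ∫ t, ∫ s, (Ψ ⁻¹' Ω).indicator (fun p => fderiv ℝ φ (Ψ p) (b 1)) (t, s) ≤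
      ∫ t, max (∫ s, (Ψ ⁻¹' Ω).indicator (fun p => fderiv ℝ φ (Ψ p) (b 1)) (t, s)) 0 :=
    integral_mono hGi hGi.pos_part fun t => le_max_left _ _
  refine h1.trans ?_
  rw [← ENNReal.ofReal_le_ofReal_iff (integral_nonneg hφ0),
    ofReal_integral_eq_lintegral_ofReal hGi.pos_part (Filter.Eventually.of_forall fun t => le_max_right _ _)]
  simpa [ENNReal.ofReal_max] using key

lemma bbmp_integrable_frontier {Ω : Set (EuclideanSpace ℝ (Fin 2))} 
    (hbdd : Bornology.IsBounded Ω) (hH : μH[1] (frontier Ω) ≠ ⊤)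
    {φ : EuclideanSpace ℝ (Fin 2) → ℝ} (hφ : Continuous φ) :
    IntegrableOn φ (frontier Ω) μH[1] := by
  have hc : IsCompact (frontier Ω) := isCompact_of_isClosed_isBounded isClosed_frontier
    (hbdd.closure.subset frontier_subset_closure)
  obtain ⟨C, hC⟩ := hc.exists_bound_of_continuousOn hφ.continuousOn
  refine IntegrableOn.of_bound (lt_top_iff_ne_top.2 hH) hφ.aestronglyMeasurable C ?_
  exact (ae_restrict_iff' isClosed_frontier.measurableSet).2 (Filter.Eventually.of_forall hC)

lemma bbmp_slice (Ω : Set (EuclideanSpace ℝ (Fin 2))) (hopen : IsOpen Ω)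
    (hbdd : Bornology.IsBounded Ω) (hH : μH[1] (frontier Ω) ≠ ⊤)
    (φ : EuclideanSpace ℝ (Fin 2) → ℝ) (hφ : ContDiff ℝ 1 φ) 
    (h0 : ∀ x, 0 ≤ φ x) (v : EuclideanSpace ℝ (Fin 2)) :
    ∫ x in Ω, fderiv ℝ φ x v ≤ ‖v‖ * ∫ x in frontier Ω, φ x ∂μH[1] := by
  by_cases hv : v = 0
  · simp [hv]
  have hv' : 0 < ‖v‖ := norm_pos_iff.2 hv
  obtain ⟨b, hb⟩ := bbmp_onb (‖v‖⁻¹ • v) (by rw [norm_smul]; simp [hv'.ne'])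
  have hvb : v = ‖v‖ • b 1 := by rw [hb, smul_smul, mul_inv_cancel₀ hv'.ne', one_smul]
  have h1 : ∫ x in Ω, fderiv ℝ φ x v = ‖v‖ * ∫ x in Ω, fderiv ℝ φ x (b 1) := by
    rw [← integral_const_mul]
    congr 1; funext x
    conv_lhs => rw [hvb]
    simp
  rw [h1]
  refine mul_le_mul_of_nonneg_left ?_ hv'.le
  refine le_of_forall_pos_le_add fun ε hε => ?_
  set L := (μH[1] (frontier Ω)).toReal with hL
  have hL0 : 0 ≤ L := ENNReal.toReal_nonneg
  set δ := ε / (L + 1) with hδ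
  have hδ0 : 0 < δ := by positivity
  have := bbmp_slice_pos Ω hopen hbdd hH (fun x => φ x + δ) (hφ.add contDiff_const) hδ0
    (fun x => by linarith [h0 x]) b
  simp only [fderiv_add_const] at this
  refine this.trans ?_
  rw [integral_add (bbmp_integrable_frontier hbdd hH hφ.continuous)
    (bbmp_integrable_frontier hbdd hH continuous_const), setIntegral_const, smul_eq_mul,
    Measure.real, ← hL]
  have : L * δ ≤ ε := by
    rw [hδ, mul_div_assoc', div_le_iff₀ (by positivity)]
    nlinarith
  linarith


lemma bbmp_intOn {Ω : Set (EuclideanSpace ℝ (Fin 2))} 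
    (hbdd : Bornology.IsBounded Ω) 
    {φ : EuclideanSpace ℝ (Fin 2) → ℝ} (hφ : Continuous φ) :
    IntegrableOn φ Ω :=
  (hφ.continuousOn.integrableOn_compact hbdd.isCompact_closure).mono_set subset_closure

lemma bbmp_cfd {φ : EuclideanSpace ℝ (Fin 2) → ℝ} (hφ : ContDiff ℝ 1 φ)
    (v : EuclideanSpace ℝ (Fin 2)) : Continuous (fun x => fderiv ℝ φ x v) :=
  (hφ.continuous_fderiv one_ne_zero).clm_apply continuous_const

lemma bbmp_osc (Ω : Set (EuclideanSpace ℝ (Fin 2))) (hopen : IsOpen Ω)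
    (hbdd : Bornology.IsBounded Ω) (hH : μH[1] (frontier Ω) ≠ ⊤)
    (η ψ : EuclideanSpace ℝ (Fin 2) → ℝ) (hη : ContDiff ℝ 1 η) (hψ : ContDiff ℝ 1 ψ) 
    (h0 : ∀ x, 0 ≤ η x) {ε : ℝ} (hε : 0 < ε) (h1 : ∀ x, |ψ x| ≤ ε * η x)
    (v : EuclideanSpace ℝ (Fin 2)) (hv : ‖v‖ = 1) :
    ∫ x in Ω, fderiv ℝ ψ x v ≤ 3 * ε * ∫ x in frontier Ω, η x ∂μH[1] := by
  have a1 := bbmp_slice Ω hopen hbdd hH (fun x => ψ x + ε * η x) (by fun_prop)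
    (fun x => by linarith [neg_abs_le (ψ x), h1 x]) v
  have a2 := bbmp_slice Ω hopen hbdd hH η hη h0 (-v)
  have hd : ∀ x, fderiv ℝ (fun x => ψ x + ε * η x) x v = fderiv ℝ ψ x v + ε * fderiv ℝ η x v := by
    intro x
    have d1 := (hψ.differentiable one_ne_zero x).hasFDerivAt
    have d2 := (hη.differentiable one_ne_zero x).hasFDerivAt
    rw [(d1.fun_add (d2.const_mul ε)).fderiv]
    simp
  simp only [hd, hv, norm_neg, one_mul, map_neg] at a1 a2
  rw [integral_add (bbmp_intOn hbdd (bbmp_cfd hψ v))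
    ((bbmp_intOn hbdd (bbmp_cfd hη v)).const_mul ε), integral_const_mul] at a1
  rw [integral_neg] at a2
  have a3 : ∫ x in frontier Ω, (ψ x + ε * η x) ∂μH[1] ≤ ∫ x in frontier Ω, 2 * ε * η x ∂μH[1] := by
    apply integral_mono (bbmp_integrable_frontier hbdd hH (by fun_prop))
      (bbmp_integrable_frontier hbdd hH (by fun_prop))
    intro x
    have := le_abs_self (ψ x)
    have := h1 x
    show ψ x + ε * η x ≤ 2 * ε * η x
    linarith
  rw [integral_const_mul] at a3
  nlinarith

open scoped Manifold ContDiff in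
lemma bbmp_div (Ω : Set (EuclideanSpace ℝ (Fin 2))) (hopen : IsOpen Ω)
    (hbdd : Bornology.IsBounded Ω) (hH : μH[1] (frontier Ω) ≠ ⊤)
    (P Q M : EuclideanSpace ℝ (Fin 2) → ℝ) (hP : ContDiff ℝ 1 P) (hQ : ContDiff ℝ 1 Q)
    (hM : Continuous M) (hM0 : ∀ x, 0 ≤ M x) (hPQ : ∀ x, P x ^ 2 + Q x ^ 2 ≤ M x ^ 2) :
    ∫ x in Ω, (fderiv ℝ P x (EuclideanSpace.single 0 1) + fderiv ℝ Q x (EuclideanSpace.single 1 1))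
      ≤ ∫ x in frontier Ω, M x ∂μH[1] := by
  set e0 : EuclideanSpace ℝ (Fin 2) := EuclideanSpace.single 0 1 with he0
  set e1 : EuclideanSpace ℝ (Fin 2) := EuclideanSpace.single 1 1 with he1
  have hn0 : ‖e0‖ = 1 := by simp [he0]
  have hn1 : ‖e1‖ = 1 := by simp [he1]
  set L := (μH[1] (frontier Ω)).toReal with hL
  have hL0 : 0 ≤ L := ENNReal.toReal_nonneg
  suffices H : ∀ ε : ℝ, 0 < ε → ∫ x in Ω, (fderiv ℝ P x e0 + fderiv ℝ Q x e1)
      ≤ ∫ x in frontier Ω, M x ∂μH[1] + 7 * ε * L by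
    refine le_of_forall_pos_le_add fun ε hε => ?_
    refine (H (ε / (7 * (L + 1))) (by positivity)).trans ?_
    have : 7 * (ε / (7 * (L + 1))) * L ≤ ε := by
      have : 7 * (ε / (7 * (L + 1))) * L = ε * L / (L + 1) := by field_simp
      rw [this, div_le_iff₀ (by positivity)]
      nlinarith
    linarith
  intro ε hε
  let U : EuclideanSpace ℝ (Fin 2) → Set (EuclideanSpace ℝ (Fin 2)) := fun x =>
    {y | |P y - P x| < ε ∧ |Q y - Q x| < ε ∧ |M y - M x| < ε}
  have hPc := hP.continuous
  have hQc := hQ.continuous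
  have hUo : ∀ x, IsOpen (U x) := by
    intro x
    have h : ∀ R : EuclideanSpace ℝ (Fin 2) → ℝ, Continuous R → IsOpen {y | |R y - R x| < ε} :=
      fun R hR => isOpen_lt (by fun_prop) continuous_const
    exact (h P hPc).inter ((h Q hQc).inter (h M hM))
  obtain ⟨T, -, hT⟩ := hbdd.isCompact_closure.elim_nhds_subcover U
    (fun x _ => (hUo x).mem_nhds (by simp [U, hε]))
  obtain ⟨f, hf⟩ := SmoothPartitionOfUnity.exists_isSubordinate 𝓘(ℝ, EuclideanSpace ℝ (Fin 2))
    (s := closure Ω) isClosed_closure (fun i : T => U i) (fun i => hUo i) (by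
      intro x hx
      obtain ⟨i, hi, hxi⟩ := Set.mem_iUnion₂.1 (hT hx)
      exact Set.mem_iUnion.2 ⟨⟨i, hi⟩, hxi⟩)
  have hη : ∀ i, ContDiff ℝ 1 (fun x => f i x) := fun i =>
    ((f i).contMDiff.contDiff).of_le (by norm_num)
  have hη0 : ∀ i x, 0 ≤ f i x := fun i x => f.nonneg i x
  have hsum : ∀ x ∈ closure Ω, ∑ i, f i x = 1 := by
    intro x hx
    rw [← finsum_eq_sum_of_fintype]
    exact f.sum_eq_one hx
  have hsupp : ∀ i x, f i x ≠ 0 → x ∈ U i := fun i x hx => hf i (subset_tsupport _ hx)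
  let v : T → EuclideanSpace ℝ (Fin 2) := fun i => P i • e0 + Q i • e1
  have hv : ∀ i, ‖v i‖ ≤ M i := by
    intro i
    have : ‖v i‖ ^ 2 = P i ^ 2 + Q i ^ 2 := by
      rw [EuclideanSpace.norm_sq_eq]
      simp [v, he0, he1, Fin.sum_univ_two]
    exact abs_le_of_sq_le_sq' (this ▸ hPQ i) (hM0 i) |>.2
  have hψ : ∀ i, ContDiff ℝ 1 (fun x => f i x * (P x - P i)) := fun i => by
    have := hη i; fun_prop
  have hχ : ∀ i, ContDiff ℝ 1 (fun x => f i x * (Q x - Q i)) := fun i => by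
    have := hη i; fun_prop
  have hdec : ∀ (R : EuclideanSpace ℝ (Fin 2) → ℝ) (hR : ContDiff ℝ 1 R) (e : EuclideanSpace ℝ (Fin 2)),
      ∀ x ∈ Ω, fderiv ℝ R x e = ∑ i : T, (R i * fderiv ℝ (fun x => f i x) x e
        + fderiv ℝ (fun x => f i x * (R x - R i)) x e) := by
    intro R hR e x hx
    have h1 : R =ᶠ[nhds x] fun y => ∑ i : T, (R i * f i y + f i y * (R y - R i)) := by
      filter_upwards [hopen.mem_nhds hx] with y hy
      have : ∀ i : T, R i * f i y + f i y * (R y - R i) = f i y * R y := fun i => by ring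
      simp only [this]
      rw [← Finset.sum_mul, hsum y (subset_closure hy), one_mul]
    have hRd := hR.differentiable one_ne_zero x
    have hfd : ∀ i, DifferentiableAt ℝ (fun x => f i x) x := fun i =>
      (hη i).differentiable one_ne_zero x
    have h2 : HasFDerivAt (fun y => ∑ i : T, (R i * f i y + f i y * (R y - R i)))
        (∑ i : T, (R i • fderiv ℝ (fun x => f i x) x + fderiv ℝ (fun x => f i x * (R x - R i)) x)) x := by
      refine HasFDerivAt.fun_sum fun i _ => ?_
      refine ((hfd i).hasFDerivAt.const_mul (R i)).add ?_
      exact ((hfd i).fun_mul (hRd.sub_const _)).hasFDerivAt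
    rw [h1.fderiv_eq, h2.fderiv]
    simp
  have hterm : ∀ i : T, ∫ x in Ω, (fderiv ℝ (fun x => f i x) x (v i)
      + (fderiv ℝ (fun x => f i x * (P x - P i)) x e0
      + fderiv ℝ (fun x => f i x * (Q x - Q i)) x e1)) ≤
      ∫ x in frontier Ω, f i x * (M x + 7 * ε) ∂μH[1] := by
    intro i
    have hfc : Continuous (fun x => f i x) := (hη i).continuous
    have hadd : IntegrableOn (fun x => fderiv ℝ (fun x => f i x * (P x - P i)) x e0
        + fderiv ℝ (fun x => f i x * (Q x - Q i)) x e1) Ω :=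
      bbmp_intOn hbdd ((bbmp_cfd (hψ i) _).add (bbmp_cfd (hχ i) _))
    rw [integral_add (bbmp_intOn hbdd (bbmp_cfd (hη i) _)) hadd,
      integral_add (bbmp_intOn hbdd (bbmp_cfd (hψ i) _)) (bbmp_intOn hbdd (bbmp_cfd (hχ i) _))]
    have b1 := bbmp_slice Ω hopen hbdd hH _ (hη i) (hη0 i) (v i)
    have hb : ∀ (R : EuclideanSpace ℝ (Fin 2) → ℝ), (∀ x ∈ U i, |R x - R i| < ε) → 
        ∀ x, |f i x * (R x - R i)| ≤ ε * f i x := by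
      intro R hR x
      by_cases h : f i x = 0
      · simp [h]
      · rw [abs_mul, abs_of_nonneg (hη0 i x), mul_comm ε]
        exact mul_le_mul_of_nonneg_left (hR x (hsupp i x h)).le (hη0 i x)
    have b2 := bbmp_osc Ω hopen hbdd hH _ _ (hη i) (hψ i) (hη0 i) hε 
      (hb P fun x hx => hx.1) e0 hn0
    have b3 := bbmp_osc Ω hopen hbdd hH _ _ (hη i) (hχ i) (hη0 i) hε 
      (hb Q fun x hx => hx.2.1) e1 hn1
    have hI : 0 ≤ ∫ x in frontier Ω, f i x ∂μH[1] := integral_nonneg (hη0 i)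
    have b4 : (M i + 6 * ε) * ∫ x in frontier Ω, f i x ∂μH[1] ≤ 
        ∫ x in frontier Ω, f i x * (M x + 7 * ε) ∂μH[1] := by
      rw [← integral_const_mul]
      apply integral_mono (bbmp_integrable_frontier hbdd hH (by fun_prop))
        (bbmp_integrable_frontier hbdd hH (by fun_prop))
      intro x
      show (M i + 6 * ε) * f i x ≤ f i x * (M x + 7 * ε)
      by_cases h : f i x = 0
      · simp [h]
      · have := (abs_lt.1 (hsupp i x h).2.2).1
        rw [mul_comm]
        exact mul_le_mul_of_nonneg_left (by linarith) (hη0 i x)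
    have b5 := mul_le_mul_of_nonneg_right (hv i) hI
    linarith
  have hcd : ∀ i : T, Continuous (fun x => (fderiv ℝ (fun x => f i x) x (v i)
      + (fderiv ℝ (fun x => f i x * (P x - P i)) x e0
      + fderiv ℝ (fun x => f i x * (Q x - Q i)) x e1))) := fun i =>
    (bbmp_cfd (hη i) _).add ((bbmp_cfd (hψ i) _).add (bbmp_cfd (hχ i) _))
  calc ∫ x in Ω, (fderiv ℝ P x e0 + fderiv ℝ Q x e1)
      = ∫ x in Ω, ∑ i : T, (fderiv ℝ (fun x => f i x) x (v i)
      + (fderiv ℝ (fun x => f i x * (P x - P i)) x e0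
      + fderiv ℝ (fun x => f i x * (Q x - Q i)) x e1)) := by
        refine setIntegral_congr_fun hopen.measurableSet fun x hx => ?_
        show fderiv ℝ P x e0 + fderiv ℝ Q x e1 = _
        rw [hdec P hP e0 x hx, hdec Q hQ e1 x hx, ← Finset.sum_add_distrib]
        refine Finset.sum_congr rfl fun i _ => ?_
        simp only [v, map_add, map_smul, smul_eq_mul]
        ring
    _ = ∑ i : T, ∫ x in Ω, (fderiv ℝ (fun x => f i x) x (v i)
      + (fderiv ℝ (fun x => f i x * (P x - P i)) x e0
      + fderiv ℝ (fun x => f i x * (Q x - Q i)) x e1)) :=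
        integral_finsetSum _ fun i _ => bbmp_intOn hbdd (hcd i)
    _ ≤ ∑ i : T, ∫ x in frontier Ω, f i x * (M x + 7 * ε) ∂μH[1] :=
        Finset.sum_le_sum fun i _ => hterm i
    _ = ∫ x in frontier Ω, ∑ i : T, f i x * (M x + 7 * ε) ∂μH[1] := by
        rw [integral_finsetSum]
        intro i _
        have hfc : Continuous (fun x => f i x) := (hη i).continuous
        exact bbmp_integrable_frontier hbdd hH (by fun_prop)
    _ = ∫ x in frontier Ω, (M x + 7 * ε) ∂μH[1] := by
        refine setIntegral_congr_fun isClosed_frontier.measurableSet fun x hx => ?_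
        show ∑ i : T, f i x * (M x + 7 * ε) = _
        rw [← Finset.sum_mul, hsum x (frontier_subset_closure hx), one_mul]
    _ = _ := by
        rw [integral_add (bbmp_integrable_frontier hbdd hH hM)
          (bbmp_integrable_frontier hbdd hH continuous_const), setIntegral_const, smul_eq_mul,
          Measure.real, ← hL]
        ring


lemma bbmp_fatou (Ω : Set (EuclideanSpace ℝ (Fin 2))) (hopen : IsOpen Ω)
    (hbdd : Bornology.IsBounded Ω) (f : ℕ → EuclideanSpace ℝ (Fin 2) → ℝ)
    (hf : ∀ n, Continuous (f n)) (h0 : ∀ n x, 0 ≤ f n x) (C : ℝ) 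
    (hC : ∀ n, ∫ x in Ω, f n x ≤ C) (S : Set (EuclideanSpace ℝ (Fin 2))) (hS : MeasurableSet S)
    (hSΩ : S ⊆ Ω) (c : ℝ) (hc : 0 ≤ c)
    (hlim : ∀ x ∈ S, ∃ g : ℕ → ℝ, Filter.Tendsto g Filter.atTop (nhds c) ∧
      ∀ᶠ n in Filter.atTop, g n ≤ f n x) : c * (volume S).toReal ≤ C := by
  have hC0 : 0 ≤ C := le_trans (integral_nonneg (h0 0)) (hC 0)
  have h1 : ENNReal.ofReal c * volume S ≤ ENNReal.ofReal C := by
    calc ENNReal.ofReal c * volume S = ∫⁻ x in S, ENNReal.ofReal c := by simp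
      _ ≤ ∫⁻ x in S, Filter.liminf (fun n => ENNReal.ofReal (f n x)) Filter.atTop := by
          apply setLIntegral_mono' hS
          intro x hx
          obtain ⟨g, hg, hgf⟩ := hlim x hx
          have := (ENNReal.tendsto_ofReal hg).liminf_eq
          rw [← this]
          refine Filter.liminf_le_liminf ?_
          filter_upwards [hgf] with n hn
          exact ENNReal.ofReal_le_ofReal hn
      _ ≤ Filter.liminf (fun n => ∫⁻ x in S, ENNReal.ofReal (f n x)) Filter.atTop := by
          apply lintegral_liminf_le
          intro n
          exact ENNReal.measurable_ofReal.comp (hf n).measurable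
      _ ≤ ENNReal.ofReal C := by
          apply Filter.liminf_le_of_le
          · isBoundedDefault
          · intro b hb
            obtain ⟨n, hn⟩ := hb.exists
            refine hn.trans ?_
            refine (lintegral_mono_set hSΩ).trans ?_
            rw [← ofReal_integral_eq_lintegral_ofReal (bbmp_intOn hbdd (hf n))
              (Filter.Eventually.of_forall (h0 n))]
            exact ENNReal.ofReal_le_ofReal (hC n)
  have := ENNReal.toReal_mono ENNReal.ofReal_ne_top h1
  rwa [ENNReal.toReal_mul, ENNReal.toReal_ofReal hc, ENNReal.toReal_ofReal hC0] at this

lemma bbmp_conv (Ω : Set (EuclideanSpace ℝ (Fin 2))) 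
    (hbdd : Bornology.IsBounded Ω) (K : EuclideanSpace ℝ (Fin 2) → ℝ) (hK : ContDiff ℝ 1 K) :
    ContDiff ℝ 1 (fun x => ∫ y in Ω, K (x - y)) ∧
    ∀ x v, fderiv ℝ (fun x => ∫ y in Ω, K (x - y)) x v = ∫ y in Ω, fderiv ℝ K (x - y) v := by
  have hKc := hK.continuous
  have hK' := hK.continuous_fderiv one_ne_zero
  have hIntg : ∀ x, IntegrableOn (fun y => fderiv ℝ K (x - y)) Ω := fun x =>
    ((hK'.comp (continuous_const.sub continuous_id)).continuousOn.integrableOn_compact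
      hbdd.isCompact_closure).mono_set subset_closure
  have hd : ∀ x, HasFDerivAt (fun x => ∫ y in Ω, K (x - y)) (∫ y in Ω, fderiv ℝ K (x - y)) x := by
    intro x
    have hcpt : IsCompact (closedBall x 1 ×ˢ closure Ω) :=
      (isCompact_closedBall x 1).prod hbdd.isCompact_closure
    obtain ⟨M, hM⟩ := hcpt.bddAbove_image (f := fun p => ‖fderiv ℝ K (p.1 - p.2)‖) 
      (by fun_prop)
    apply hasFDerivAt_integral_of_dominated_of_fderiv_le (s := closedBall x 1)
      (bound := fun _ => M) (F := fun x y => K (x - y)) (F' := fun x y => fderiv ℝ K (x - y))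
      (closedBall_mem_nhds x one_pos)
    · refine Filter.Eventually.of_forall fun z => ?_
      exact (by fun_prop : Continuous fun y => K (z - y)).aestronglyMeasurable
    · exact bbmp_intOn hbdd (by fun_prop : Continuous fun y => K (x - y))
    · exact (hIntg x).aestronglyMeasurable
    · have : ∀ᵐ y ∂(volume.restrict (closure Ω)), y ∈ closure Ω :=
        ae_restrict_mem isClosed_closure.measurableSet
      have := ae_mono (Measure.restrict_mono_set volume (subset_closure (s := Ω))) this
      filter_upwards [this] with y hy z hz
      exact hM ⟨(z, y), ⟨hz, hy⟩, rfl⟩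
    · exact bbmp_intOn hbdd continuous_const
    · refine Filter.Eventually.of_forall fun y z _ => ?_
      have := (hK.differentiable one_ne_zero (z - y)).hasFDerivAt
      simpa [Function.comp_def] using this.comp z ((hasFDerivAt_id z).sub_const y)
  refine ⟨?_, ?_⟩
  · rw [contDiff_one_iff_fderiv]
    refine ⟨fun x => (hd x).differentiableAt, ?_⟩
    have : fderiv ℝ (fun x => ∫ y in Ω, K (x - y)) = fun x => ∫ y in Ω, fderiv ℝ K (x - y) :=
      funext fun x => (hd x).fderiv
    rw [this]
    have := continuous_parametric_integral_of_continuous (μ := volume.restrict Ω) 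
      (f := fun x y => fderiv ℝ K (x - y)) (s := closure Ω) 
      (by unfold Function.uncurry; fun_prop) hbdd.isCompact_closure
    rwa [Measure.restrict_restrict isClosed_closure.measurableSet,
      Set.inter_eq_right.mpr subset_closure] at this
  · intro x v
    rw [(hd x).fderiv, ContinuousLinearMap.integral_apply (hIntg x)]


lemma bbmp_volball (x : EuclideanSpace ℝ (Fin 2)) (r : ℝ) (hr : 0 ≤ r) :
    (volume (ball x r)).toReal = π * r ^ 2 := by
  rw [EuclideanSpace.volume_ball_fin_two]
  simp [ENNReal.toReal_ofReal hr, ENNReal.toReal_ofReal pi_pos.le]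
  ring

lemma bbmp_kint (d ε : ℝ) (hd : 0 < d) (hε : 0 < ε) :
    ∫ z in ball (0 : EuclideanSpace ℝ (Fin 2)) d, 2 * ε ^ 2 / (‖z‖ ^ 2 + ε ^ 2) ^ 2 =
      2 * π * (d ^ 2 / (d ^ 2 + ε ^ 2)) := by
  set h : ℝ → ℝ := fun y => 2 * ε ^ 2 / (y ^ 2 + ε ^ 2) ^ 2 with hh
  have hpos : ∀ y : ℝ, 0 < y ^ 2 + ε ^ 2 := fun y => by positivity
  rw [← integral_indicator measurableSet_ball]
  have e1 : ∀ z : EuclideanSpace ℝ (Fin 2), (ball (0 : EuclideanSpace ℝ (Fin 2)) d).indicator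
      (fun z => 2 * ε ^ 2 / (‖z‖ ^ 2 + ε ^ 2) ^ 2) z = (Set.Iio d).indicator h ‖z‖ := by
    intro z
    by_cases hz : ‖z‖ < d
    · rw [Set.indicator_of_mem (by simpa using hz), Set.indicator_of_mem (by simpa using hz)]
    · rw [Set.indicator_of_notMem (by simpa using hz), Set.indicator_of_notMem (by simpa using hz)]
  simp_rw [e1]
  rw [integral_fun_norm_addHaar volume ((Set.Iio d).indicator h)]
  have e2 : (volume : Measure (EuclideanSpace ℝ (Fin 2))).real (ball 0 1) = π := by
    have := bbmp_volball 0 1 zero_le_one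
    rw [Measure.real, this]
    ring
  have e3 : ∫ y in Set.Ioi (0 : ℝ), y ^ (2 - 1) • (Set.Iio d).indicator h y = 
      d ^ 2 / (d ^ 2 + ε ^ 2) := by
    have : ∀ y : ℝ, y ^ (2 - 1) • (Set.Iio d).indicator h y = 
        (Set.Iio d).indicator (fun y => y * h y) y := by
      intro y
      by_cases hy : y < d <;> simp [Set.indicator, hy]
    simp_rw [this]
    rw [setIntegral_indicator measurableSet_Iio, Set.Ioi_inter_Iio, ← integral_Ioc_eq_integral_Ioo,
      ← intervalIntegral.integral_of_le hd.le]
    rw [intervalIntegral.integral_eq_sub_of_hasDerivAt (f := fun y => - (ε ^ 2 / (y ^ 2 + ε ^ 2)))]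
    · have := hpos d
      field_simp
      ring
    · intro y _
      have h1 : HasDerivAt (fun y : ℝ => y ^ 2 + ε ^ 2) (2 * y) y := by
        simpa using (hasDerivAt_pow 2 y).add_const (ε ^ 2)
      have := ((hasDerivAt_const y (ε ^ 2)).div h1 (hpos y).ne').neg
      refine this.congr_deriv ?_
      simp only [hh]
      have := hpos y
      field_simp
      ring
    · apply Continuous.intervalIntegrable
      simp only [hh]
      have : ∀ y : ℝ, (y ^ 2 + ε ^ 2) ^ 2 ≠ 0 := fun y => (pow_pos (hpos y) 2).ne'
      fun_prop (disch := assumption)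
  simp only [finrank_euclideanSpace, Fintype.card_fin, e2, e3]
  simp
  ring

lemma bbmp_kcont (ε : ℝ) (hε : 0 < ε) : Continuous
    (fun z : EuclideanSpace ℝ (Fin 2) => 2 * ε ^ 2 / (‖z‖ ^ 2 + ε ^ 2) ^ 2) := by
  have : ∀ y : EuclideanSpace ℝ (Fin 2), (‖y‖ ^ 2 + ε ^ 2) ^ 2 ≠ 0 := fun y => by positivity
  fun_prop (disch := assumption)

lemma bbmp_klower (Ω : Set (EuclideanSpace ℝ (Fin 2))) (hopen : IsOpen Ω)
    (hbdd : Bornology.IsBounded Ω) (x : EuclideanSpace ℝ (Fin 2)) 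
    (d ε : ℝ) (hd : 0 < d) (hε : 0 < ε) (hx : ball x d ⊆ Ω) :
    2 * π * (d ^ 2 / (d ^ 2 + ε ^ 2)) ≤ ∫ y in Ω, 2 * ε ^ 2 / (‖x - y‖ ^ 2 + ε ^ 2) ^ 2 := by
  have hc : Continuous (fun y => 2 * ε ^ 2 / (‖x - y‖ ^ 2 + ε ^ 2) ^ 2) := 
    (bbmp_kcont ε hε).comp (continuous_const.sub continuous_id)
  rw [← bbmp_kint d ε hd hε]
  have := setIntegral_mono_set (bbmp_intOn hbdd hc)
    (Filter.Eventually.of_forall fun y => by simp only [Pi.zero_apply]; positivity) 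
      (LE.le.eventuallyLE hx)
  refine le_trans (le_of_eq ?_) this
  rw [← integral_indicator measurableSet_ball, ← integral_indicator measurableSet_ball,
    ← integral_sub_left_eq_self _ volume x]
  congr 1
  funext y
  simp only [Set.indicator, mem_ball, dist_eq_norm, sub_zero, norm_sub_rev y x]

lemma bbmp_kdiff (ε : ℝ) (hε : 0 < ε) (i : Fin 2) : 
    ContDiff ℝ 1 (fun z : EuclideanSpace ℝ (Fin 2) => z i / (‖z‖ ^ 2 + ε ^ 2)) ∧
    ∀ z : EuclideanSpace ℝ (Fin 2), 
      fderiv ℝ (fun z : EuclideanSpace ℝ (Fin 2) => z i / (‖z‖ ^ 2 + ε ^ 2)) z 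
        (EuclideanSpace.single i 1) = 1 / (‖z‖ ^ 2 + ε ^ 2) - 2 * (z i) ^ 2 / (‖z‖ ^ 2 + ε ^ 2) ^ 2 := by
  have hpos : ∀ y : EuclideanSpace ℝ (Fin 2), (‖y‖ ^ 2 + ε ^ 2) ≠ 0 := fun y => by positivity
  have hi : ContDiff ℝ 1 (fun z : EuclideanSpace ℝ (Fin 2) => z i) := by fun_prop
  refine ⟨hi.div ((contDiff_norm_sq ℝ).add contDiff_const) hpos, fun z => ?_⟩
  have h1 : HasFDerivAt (fun z : EuclideanSpace ℝ (Fin 2) => z i) 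
    (EuclideanSpace.proj i : EuclideanSpace ℝ (Fin 2) →L[ℝ] ℝ) z := 
      (EuclideanSpace.proj i : EuclideanSpace ℝ (Fin 2) →L[ℝ] ℝ).hasFDerivAt
  have h2 := ((hasStrictFDerivAt_norm_sq z).hasFDerivAt).add_const (ε ^ 2)
  have h3 := h1.mul ((hasDerivAt_inv (hpos z)).comp_hasFDerivAt z h2)
  have e : (fun z : EuclideanSpace ℝ (Fin 2) => z i / (‖z‖ ^ 2 + ε ^ 2)) = 
    (fun z : EuclideanSpace ℝ (Fin 2) => z i) * (Inv.inv ∘ fun z => ‖z‖ ^ 2 + ε ^ 2) := by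
    funext z
    simp [div_eq_mul_inv]
  rw [e, h3.fderiv]
  have := hpos z
  simp [EuclideanSpace.inner_single_right]
  field_simp
  try ring


lemma bbmp_inner_r (s l : ℝ) (hl : 0 < l) (hs : 0 < s) :
    ∫⁻ r in Set.Ioi (0 : ℝ), ENNReal.ofReal (s - l * r) ≤ ENNReal.ofReal (s ^ 2 / (2 * l)) := by
  have hT : 0 < s / l := by positivity
  have h1 : ∫⁻ r in Set.Ioi (0 : ℝ), ENNReal.ofReal (s - l * r) ≤ 
      ∫⁻ r in Set.Ioc (0 : ℝ) (s / l), ENNReal.ofReal (s - l * r) := by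
    rw [← lintegral_indicator measurableSet_Ioi, ← lintegral_indicator measurableSet_Ioc]
    apply lintegral_mono
    intro r
    by_cases h0 : 0 < r
    · by_cases h2 : r ≤ s / l
      · simp [Set.indicator, h0, h2]
      · have : s - l * r ≤ 0 := by
          rw [not_le, div_lt_iff₀ hl] at h2
          linarith
        simp [Set.indicator, h0, ENNReal.ofReal_of_nonpos this]
    · simp [Set.indicator, h0]
  refine h1.trans ?_
  rw [← ofReal_integral_eq_lintegral_ofReal]
  · apply ENNReal.ofReal_le_ofReal
    rw [← intervalIntegral.integral_of_le hT.le]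
    rw [intervalIntegral.integral_sub (by simp) (Continuous.intervalIntegrable (by fun_prop) _ _),
      intervalIntegral.integral_const_mul]
    simp
    apply le_of_eq
    field_simp
    ring
  · exact (by fun_prop : Continuous fun r => s - l * r).integrableOn_Ioc
  · filter_upwards [ae_restrict_mem measurableSet_Ioc] with r hr
    have := (le_div_iff₀ hl).1 hr.2
    simp only [Pi.zero_apply]
    linarith

lemma bbmp_polar (u : EuclideanSpace ℝ (Fin 2)) (hu : ‖u‖ = 1) (l : ℝ) (hl : 0 < l) :
    ∫⁻ z : EuclideanSpace ℝ (Fin 2), ENNReal.ofReal (inner ℝ z u / ‖z‖ ^ 2 - l) ≤ 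
      ENNReal.ofReal (π / (4 * l)) := by
  obtain ⟨b, hb⟩ := bbmp_onb u hu
  obtain ⟨hmp, hme⟩ := bbmp_psi_mp b
  rw [← hmp.lintegral_comp_emb hme]
  have hon := b.orthonormal
  have e1 : ∀ p : ℝ × ℝ, inner ℝ (p.1 • b 0 + p.2 • b 1) u = p.2 := by
    intro p
    rw [← hb, inner_add_left, inner_smul_left, inner_smul_left, hon.2 (by decide : (0 : Fin 2) ≠ 1),
      real_inner_self_eq_norm_sq, hon.1]
    simp
  have e2 : ∀ p : ℝ × ℝ, ‖p.1 • b 0 + p.2 • b 1‖ ^ 2 = p.1 ^ 2 + p.2 ^ 2 := by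
    intro p
    rw [@norm_add_sq_real, norm_smul, norm_smul, hon.1, hon.1, inner_smul_left, inner_smul_right,
      hon.2 (by decide : (0 : Fin 2) ≠ 1)]
    simp
  simp only [e1, e2]
  rw [← lintegral_comp_polarCoord_symm]
  have e3 : ∫⁻ p in polarCoord.target, ENNReal.ofReal p.1 • 
      ENNReal.ofReal ((polarCoord.symm p).2 / ((polarCoord.symm p).1 ^ 2 + (polarCoord.symm p).2 ^ 2) - l)
      = ∫⁻ p in Set.Ioi (0 : ℝ) ×ˢ Set.Ioo (-π) π, ENNReal.ofReal (sin p.2 - l * p.1) := by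
    rw [polarCoord_target]
    apply setLIntegral_congr_fun (measurableSet_Ioi.prod measurableSet_Ioo)
    rintro ⟨r, θ⟩ ⟨hr, -⟩
    have hr : 0 < r := hr
    simp only [polarCoord_symm_apply, smul_eq_mul]
    rw [← ENNReal.ofReal_mul hr.le]
    congr 1
    have : (r * cos θ) ^ 2 + (r * sin θ) ^ 2 = r ^ 2 := by
      linear_combination r ^ 2 * sin_sq_add_cos_sq θ
    rw [this]
    field_simp
  rw [e3, Measure.volume_eq_prod, ← Measure.prod_restrict, lintegral_prod_symm _ (by fun_prop)]
  have e4 : ∀ θ ∈ Set.Ioo (-π) π, ∫⁻ r in Set.Ioi (0 : ℝ), ENNReal.ofReal (sin θ - l * r) ≤ 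
      (Set.Ioc 0 π).indicator (fun θ => ENNReal.ofReal (sin θ ^ 2 / (2 * l))) θ := by
    intro θ hθ
    by_cases h0 : 0 < θ
    · rw [Set.indicator_of_mem (show θ ∈ Set.Ioc 0 π from ⟨h0, hθ.2.le⟩)]
      exact bbmp_inner_r _ l hl (sin_pos_of_pos_of_lt_pi h0 hθ.2)
    · have hs : sin θ ≤ 0 := sin_nonpos_of_nonpos_of_neg_pi_le (not_lt.1 h0) hθ.1.le
      have : ∫⁻ r in Set.Ioi (0 : ℝ), ENNReal.ofReal (sin θ - l * r) = 
          ∫⁻ r in Set.Ioi (0 : ℝ), 0 := by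
        apply setLIntegral_congr_fun measurableSet_Ioi
        intro r hr
        apply ENNReal.ofReal_of_nonpos
        have : 0 < l * r := mul_pos hl hr
        linarith
      rw [this]
      simp
  refine (setLIntegral_mono' measurableSet_Ioo e4).trans ?_
  refine (setLIntegral_le_lintegral _ _).trans ?_
  rw [lintegral_indicator measurableSet_Ioc, ← ofReal_integral_eq_lintegral_ofReal]
  · apply ENNReal.ofReal_le_ofReal
    rw [← intervalIntegral.integral_of_le pi_pos.le, intervalIntegral.integral_div, integral_sin_sq]
    simp
    apply le_of_eq
    field_simp
    ring
  · exact (by fun_prop : Continuous fun r => sin r ^ 2 / (2 * l)).integrableOn_Ioc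
  · refine Filter.Eventually.of_forall fun r => ?_
    simp only [Pi.zero_apply]
    positivity

lemma bbmp_kbound (Ω : Set (EuclideanSpace ℝ (Fin 2))) 
    (hbdd : Bornology.IsBounded Ω) (R : ℝ) (hR : 0 < R) (hvol : (volume Ω).toReal = π * R ^ 2)
    (x u : EuclideanSpace ℝ (Fin 2)) (hu : ‖u‖ = 1) (ε : ℝ) (hε : 0 < ε) :
    ∫ y in Ω, inner ℝ (x - y) u / (‖x - y‖ ^ 2 + ε ^ 2) ≤ π * R := by
  have hc : Continuous fun y => inner ℝ (x - y) u / (‖x - y‖ ^ 2 + ε ^ 2) := by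
    have : ∀ y : EuclideanSpace ℝ (Fin 2), ‖x - y‖ ^ 2 + ε ^ 2 ≠ 0 := fun y => by positivity
    fun_prop (disch := assumption)
  set l : ℝ := 1 / (2 * R) with hl
  have hl0 : 0 < l := by positivity
  set g : EuclideanSpace ℝ (Fin 2) → ℝ := fun y => inner ℝ (x - y) u / (‖x - y‖ ^ 2 + ε ^ 2) - l with hg
  have hgc : Continuous g := hc.sub continuous_const
  have hfin : volume Ω ≠ ⊤ := hbdd.measure_lt_top.ne
  have h1 : ∫ y in Ω, g y = (∫ y in Ω, inner ℝ (x - y) u / (‖x - y‖ ^ 2 + ε ^ 2)) - l * (π * R ^ 2) := by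
    rw [integral_sub (bbmp_intOn hbdd hc) (bbmp_intOn hbdd continuous_const)]
    simp [Measure.real, hvol, mul_comm]
  have h2 : ∫ y in Ω, g y ≤ π * R / 2 := by
    have hp : ∫ y in Ω, g y ≤ ∫ y in Ω, max (g y) 0 :=
      integral_mono (bbmp_intOn hbdd hgc) (bbmp_intOn hbdd (by fun_prop)) fun y => le_max_left _ _
    refine hp.trans ?_
    rw [integral_eq_lintegral_of_nonneg_ae (f := fun y => max (g y) 0) (Filter.Eventually.of_forall fun y => le_max_right _ _)
      (by fun_prop : Continuous fun y => max (g y) 0).aestronglyMeasurable]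
    apply ENNReal.toReal_le_of_le_ofReal (by positivity)
    calc ∫⁻ y in Ω, ENNReal.ofReal (max (g y) 0) ≤ ∫⁻ y, ENNReal.ofReal (max (g y) 0) :=
          setLIntegral_le_lintegral _ _
      _ ≤ ∫⁻ y, ENNReal.ofReal (inner ℝ (x - y) u / ‖x - y‖ ^ 2 - l) := by
          apply lintegral_mono
          intro y
          simp only
          rw [ENNReal.ofReal_max]
          simp only [ENNReal.ofReal_zero, max_eq_left, zero_le]
          by_cases hi : 0 ≤ (inner ℝ (x - y) u : ℝ)
          · by_cases hz : x - y = 0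
            · simp [hg, hz]
            · apply ENNReal.ofReal_le_ofReal
              have : 0 < ‖x - y‖ := norm_pos_iff.2 hz
              simp only [hg]
              gcongr
              nlinarith
          · rw [ENNReal.ofReal_of_nonpos]
            · simp
            · have : inner ℝ (x - y) u / (‖x - y‖ ^ 2 + ε ^ 2) ≤ 0 := 
                div_nonpos_of_nonpos_of_nonneg (not_le.1 hi).le (by positivity)
              simp only [hg]
              linarith
      _ = ∫⁻ z : EuclideanSpace ℝ (Fin 2), ENNReal.ofReal (inner ℝ z u / ‖z‖ ^ 2 - l) := 
          lintegral_sub_left_eq_self (fun z : EuclideanSpace ℝ (Fin 2) => 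
            ENNReal.ofReal (inner ℝ z u / ‖z‖ ^ 2 - l)) x
      _ ≤ ENNReal.ofReal (π / (4 * l)) := bbmp_polar u hu l hl0
      _ = ENNReal.ofReal (π * R / 2) := by
          congr 1
          rw [hl]
          field_simp
          ring
  have h3 : l * (π * R ^ 2) = π * R / 2 := by
    rw [hl]
    field_simp
  linarith


lemma bbmp_isop (Ω : Set (EuclideanSpace ℝ (Fin 2))) (hopen : IsOpen Ω)
    (hbdd : Bornology.IsBounded Ω) (hH : μH[1] (frontier Ω) ≠ ⊤) 
    (R : ℝ) (hR : 0 < R) (hvol : (volume Ω).toReal = π * R ^ 2) :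
    2 * π * R ≤ (μH[1] (frontier Ω)).toReal := by
  set L := (μH[1] (frontier Ω)).toReal with hL
  have key : 2 * π * (volume Ω).toReal ≤ π * R * L := by
    let ε : ℕ → ℝ := fun n => 1 / ((n : ℝ) + 1)
    have hε : ∀ n, 0 < ε n := fun n => by positivity
    have hε0 : Filter.Tendsto ε Filter.atTop (nhds 0) := tendsto_one_div_add_atTop_nhds_zero_nat
    have hcs : ∀ n x, Continuous fun y => 2 * (ε n) ^ 2 / (‖x - y‖ ^ 2 + (ε n) ^ 2) ^ 2 := fun n x =>
      (bbmp_kcont (ε n) (hε n)).comp (continuous_const.sub continuous_id)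
    have hdiv : ∀ n x, fderiv ℝ (fun x : EuclideanSpace ℝ (Fin 2) => 
          ∫ y in Ω, (x - y) 0 / (‖x - y‖ ^ 2 + (ε n) ^ 2)) x (EuclideanSpace.single 0 1) + 
        fderiv ℝ (fun x : EuclideanSpace ℝ (Fin 2) => 
          ∫ y in Ω, (x - y) 1 / (‖x - y‖ ^ 2 + (ε n) ^ 2)) x (EuclideanSpace.single 1 1) =
        ∫ y in Ω, 2 * (ε n) ^ 2 / (‖x - y‖ ^ 2 + (ε n) ^ 2) ^ 2 := by
      intro n x
      have d0 := bbmp_kdiff (ε n) (hε n) 0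
      have d1 := bbmp_kdiff (ε n) (hε n) 1
      have c0 := bbmp_conv Ω hbdd _ d0.1
      have c1 := bbmp_conv Ω hbdd _ d1.1
      rw [c0.2 x, c1.2 x, ← integral_add]
      · congr 1
        funext y
        rw [d0.2, d1.2]
        have hp : 0 < ‖x - y‖ ^ 2 + ε n ^ 2 := by have := hε n; positivity
        have hn : ‖x - y‖ ^ 2 = (x - y) 0 ^ 2 + (x - y) 1 ^ 2 := by
          rw [EuclideanSpace.norm_sq_eq]
          simp
        field_simp
        linear_combination 2 * hn
      · exact bbmp_intOn hbdd ((bbmp_cfd d0.1 _).comp (continuous_const.sub continuous_id))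
      · exact bbmp_intOn hbdd ((bbmp_cfd d1.1 _).comp (continuous_const.sub continuous_id))
    have hcont : ∀ n, Continuous fun x => ∫ y in Ω, 2 * (ε n) ^ 2 / (‖x - y‖ ^ 2 + (ε n) ^ 2) ^ 2 := by
      intro n
      simp_rw [← hdiv n]
      exact (bbmp_cfd (bbmp_conv Ω hbdd _ (bbmp_kdiff (ε n) (hε n) 0).1).1 _).add 
        (bbmp_cfd (bbmp_conv Ω hbdd _ (bbmp_kdiff (ε n) (hε n) 1).1).1 _)
    apply bbmp_fatou Ω hopen hbdd _ hcont _ (π * R * L) _ Ω hopen.measurableSet subset_rfl _ 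
      (by positivity)
    · intro x hx
      obtain ⟨d, hd, hdx⟩ := Metric.isOpen_iff.1 hopen x hx
      refine ⟨fun n => 2 * π * (d ^ 2 / (d ^ 2 + ε n ^ 2)), ?_, 
        Filter.Eventually.of_forall fun n => bbmp_klower Ω hopen hbdd x d (ε n) hd (hε n) hdx⟩
      have : Filter.Tendsto (fun n => 2 * π * (d ^ 2 / (d ^ 2 + ε n ^ 2))) Filter.atTop
        (nhds (2 * π * (d ^ 2 / (d ^ 2 + 0 ^ 2)))) := by
        apply Filter.Tendsto.const_mul
        apply Filter.Tendsto.div tendsto_const_nhds (tendsto_const_nhds.add (hε0.pow 2))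
        positivity
      have e : 2 * π * (d ^ 2 / (d ^ 2 + 0 ^ 2)) = 2 * π := by field_simp; ring
      rwa [e] at this
    · intro n x
      apply integral_nonneg
      intro y
      simp only [Pi.zero_apply]
      positivity
    · intro n
      have hb := bbmp_div Ω hopen hbdd hH _ _ (fun _ => π * R) 
        (bbmp_conv Ω hbdd _ (bbmp_kdiff (ε n) (hε n) 0).1).1
        (bbmp_conv Ω hbdd _ (bbmp_kdiff (ε n) (hε n) 1).1).1 continuous_const 
        (fun _ => by positivity) ?_
      · simp_rw [hdiv n] at hb
        refine hb.trans (le_of_eq ?_)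
        simp [Measure.real, hL]
        ring
      · intro x
        set p := ∫ y in Ω, (x - y) 0 / (‖x - y‖ ^ 2 + (ε n) ^ 2) with hp
        set q := ∫ y in Ω, (x - y) 1 / (‖x - y‖ ^ 2 + (ε n) ^ 2) with hq
        by_cases h0 : p ^ 2 + q ^ 2 = 0
        · rw [h0]
          positivity
        have hpos : 0 < p ^ 2 + q ^ 2 := lt_of_le_of_ne (by positivity) (Ne.symm h0)
        set s := √(p ^ 2 + q ^ 2) with hs
        have hs0 : 0 < s := Real.sqrt_pos.2 hpos
        have hs2 : s ^ 2 = p ^ 2 + q ^ 2 := Real.sq_sqrt hpos.le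
        have hu : ‖(!₂[p / s, q / s] : EuclideanSpace ℝ (Fin 2))‖ = 1 := by
          rw [EuclideanSpace.norm_eq]
          simp only [Fin.sum_univ_two, Real.norm_eq_abs, sq_abs]
          simp
          field_simp
          exact hs2.symm
        have hk := bbmp_kbound Ω hbdd R hR hvol x _ hu (ε n) (hε n)
        have e : ∫ y in Ω, inner ℝ (x - y) (!₂[p / s, q / s] : EuclideanSpace ℝ (Fin 2)) / 
            (‖x - y‖ ^ 2 + ε n ^ 2) = (p / s) * p + (q / s) * q := by
          rw [hp, ← integral_const_mul, hq, ← integral_const_mul, ← integral_add]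
          · congr 1
            funext y
            simp [PiLp.inner_apply, Fin.sum_univ_two]
            ring
          · exact bbmp_intOn hbdd (((bbmp_kdiff (ε n) (hε n) 0).1.continuous.comp 
              (continuous_const.sub continuous_id)).const_mul _)
          · exact bbmp_intOn hbdd (((bbmp_kdiff (ε n) (hε n) 1).1.continuous.comp 
              (continuous_const.sub continuous_id)).const_mul _)
        rw [e] at hk
        have e2 : (p / s) * p + (q / s) * q = s := by
          field_simp
          exact hs2.symm
        rw [e2] at hk
        rw [← hs2]
        gcongr
  rw [hvol] at key
  have : 0 < π * R := by positivity
  nlinarith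


lemma bbmp_maxsq (v : ℝ) : HasDerivAt (fun v : ℝ => (max v 0) ^ 2) (2 * max v 0) v := by
  rcases lt_trichotomy v 0 with h | h | h
  · have : (fun v : ℝ => (max v 0) ^ 2) =ᶠ[nhds v] fun _ => 0 := by
      filter_upwards [Iio_mem_nhds h] with w hw
      rw [max_eq_right (le_of_lt hw)]
      simp
    rw [max_eq_right h.le]
    simpa using (hasDerivAt_const v (0 : ℝ)).congr_of_eventuallyEq this
  · subst h
    rw [hasDerivAt_iff_isLittleO]
    simp only [max_self, mul_zero, smul_zero, sub_zero, ne_eq, OfNat.ofNat_ne_zero,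
      not_false_eq_true, zero_pow]
    have h1 : (fun x' : ℝ => (max x' 0) ^ 2) =O[nhds 0] fun x' => x' ^ 2 := by
      apply Asymptotics.IsBigO.of_bound 1
      refine Filter.Eventually.of_forall fun x => ?_
      rw [one_mul, norm_pow, norm_pow]
      gcongr
      rw [Real.norm_eq_abs, Real.norm_eq_abs, abs_of_nonneg (le_max_right x 0)]
      exact max_le (le_abs_self x) (abs_nonneg x)
    exact h1.trans_isLittleO (Asymptotics.isLittleO_pow_id (by norm_num))
  · have : (fun v : ℝ => (max v 0) ^ 2) =ᶠ[nhds v] fun v => v ^ 2 := by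
      filter_upwards [Ioi_mem_nhds h] with w hw
      rw [max_eq_left (le_of_lt hw)]
    rw [max_eq_left h.le]
    simpa using (hasDerivAt_pow 2 v).congr_of_eventuallyEq this

noncomputable def bbmpS (δ v : ℝ) : ℝ := ((max v 0) ^ 2 - (max (v - δ) 0) ^ 2) / (2 * δ)

lemma bbmpS_deriv (δ v : ℝ) (hδ : 0 < δ) : 
    HasDerivAt (bbmpS δ) ((max v 0 - max (v - δ) 0) / δ) v := by
  have h2 := (bbmp_maxsq (v - δ)).comp v ((hasDerivAt_id v).sub_const δ)
  have := ((bbmp_maxsq v).sub h2).div_const (2 * δ)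
  refine this.congr_deriv ?_
  field_simp
  

lemma bbmpS_contDiff (δ : ℝ) (hδ : 0 < δ) : ContDiff ℝ 1 (bbmpS δ) := by
  rw [contDiff_one_iff_deriv]
  refine ⟨fun v => (bbmpS_deriv δ v hδ).differentiableAt, ?_⟩
  have : deriv (bbmpS δ) = fun v => (max v 0 - max (v - δ) 0) / δ := 
    funext fun v => (bbmpS_deriv δ v hδ).deriv
  rw [this]
  fun_prop

lemma bbmpS_nonneg (δ v : ℝ) (hδ : 0 < δ) : 0 ≤ bbmpS δ v := by
  unfold bbmpS
  apply div_nonneg _ (by positivity)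
  have : max (v - δ) 0 ≤ max v 0 := max_le_max (by linarith) le_rfl
  have h0 : 0 ≤ max (v - δ) 0 := le_max_right _ _
  nlinarith

lemma bbmpS_le (δ v : ℝ) (hδ : 0 < δ) : bbmpS δ v ≤ max v 0 := by
  unfold bbmpS
  rw [div_le_iff₀ (by positivity)]
  rcases le_total v 0 with h | h
  · rw [max_eq_right h, max_eq_right (by linarith : v - δ ≤ 0)]
    simp
  · rcases le_total v δ with h' | h'
    · rw [max_eq_left h, max_eq_right (by linarith : v - δ ≤ 0)]
      nlinarith
    · rw [max_eq_left h, max_eq_left (by linarith : 0 ≤ v - δ)]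
      nlinarith

lemma bbmp_field (δ m z0 : ℝ) (hδ : 0 < δ) (i : Fin 2) :
    ContDiff ℝ 1 (fun x : EuclideanSpace ℝ (Fin 2) => 
      m * bbmpS δ ((‖x‖ ^ 2 - z0) / (‖x‖ ^ 2 + δ)) * x i) ∧ 
    ∀ x : EuclideanSpace ℝ (Fin 2), fderiv ℝ (fun x : EuclideanSpace ℝ (Fin 2) => 
      m * bbmpS δ ((‖x‖ ^ 2 - z0) / (‖x‖ ^ 2 + δ)) * x i) x (EuclideanSpace.single i 1) =
      m * bbmpS δ ((‖x‖ ^ 2 - z0) / (‖x‖ ^ 2 + δ)) + 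
      2 * m * ((max ((‖x‖ ^ 2 - z0) / (‖x‖ ^ 2 + δ)) 0 - max ((‖x‖ ^ 2 - z0) / (‖x‖ ^ 2 + δ) - δ) 0) / δ) *
        ((z0 + δ) / (‖x‖ ^ 2 + δ) ^ 2) * (x i) ^ 2 := by
  have hpos : ∀ y : EuclideanSpace ℝ (Fin 2), (‖y‖ ^ 2 + δ) ≠ 0 := fun y => by positivity
  have hi : ContDiff ℝ 1 (fun z : EuclideanSpace ℝ (Fin 2) => z i) := by fun_prop
  have hw : ContDiff ℝ 1 (fun x : EuclideanSpace ℝ (Fin 2) => (‖x‖ ^ 2 - z0) / (‖x‖ ^ 2 + δ)) :=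
    ((contDiff_norm_sq ℝ).sub contDiff_const).div ((contDiff_norm_sq ℝ).add contDiff_const) hpos
  refine ⟨(contDiff_const.mul ((bbmpS_contDiff δ hδ).comp hw)).mul hi, fun x => ?_⟩
  have h1 : HasFDerivAt (fun z : EuclideanSpace ℝ (Fin 2) => z i) 
    (EuclideanSpace.proj i : EuclideanSpace ℝ (Fin 2) →L[ℝ] ℝ) x := 
      (EuclideanSpace.proj i : EuclideanSpace ℝ (Fin 2) →L[ℝ] ℝ).hasFDerivAt
  have hq : HasDerivAt (fun t : ℝ => (t - z0) / (t + δ)) ((z0 + δ) / (‖x‖ ^ 2 + δ) ^ 2) (‖x‖ ^ 2) := by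
    have := ((hasDerivAt_id (‖x‖ ^ 2)).sub_const z0).div ((hasDerivAt_id (‖x‖ ^ 2)).add_const δ) (hpos x)
    refine this.congr_deriv ?_
    simp
    ring
  have h2 := ((bbmpS_deriv δ ((‖x‖ ^ 2 - z0) / (‖x‖ ^ 2 + δ)) hδ).comp (‖x‖ ^ 2) hq).comp_hasFDerivAt x
    ((hasStrictFDerivAt_norm_sq x).hasFDerivAt)
  have h3 := (h2.const_mul m).mul h1
  have e : (fun x : EuclideanSpace ℝ (Fin 2) => 
      m * bbmpS δ ((‖x‖ ^ 2 - z0) / (‖x‖ ^ 2 + δ)) * x i) = 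
      (fun y => m * ((bbmpS δ ∘ fun t => (t - z0) / (t + δ)) ∘ fun x : EuclideanSpace ℝ (Fin 2) => ‖x‖ ^ 2) y) * fun z : EuclideanSpace ℝ (Fin 2) => z i := by
    funext z
    simp
  rw [e, h3.fderiv]
  simp [EuclideanSpace.inner_single_right]
  ring

lemma bbmp_part2 (Ω : Set (EuclideanSpace ℝ (Fin 2))) (hopen : IsOpen Ω)
    (hbdd : Bornology.IsBounded Ω) (hH : μH[1] (frontier Ω) ≠ ⊤) 
    (b : ℝ → ℝ) (m z0 : ℝ) (hm : 0 < m) (hz0 : 0 ≤ z0) (hb0 : ∀ t, 0 ≤ t → 0 ≤ b t)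
    (hb : ∀ t, 0 ≤ t → m * (t ^ 2 - z0) ≤ b t * t) 
    (hbi : IntegrableOn (fun x => b ‖x‖) (frontier Ω) μH[1]) :
    2 * m * (volume (Ω \ closedBall 0 √z0)).toReal ≤ ∫ x in frontier Ω, b ‖x‖ ∂μH[1] := by
  let δ : ℕ → ℝ := fun n => 1 / ((n : ℝ) + 1)
  have hδ : ∀ n, 0 < δ n := fun n => by positivity
  have hδ0 : Filter.Tendsto δ Filter.atTop (nhds 0) := tendsto_one_div_add_atTop_nhds_zero_nat
  let P : ℕ → Fin 2 → EuclideanSpace ℝ (Fin 2) → ℝ := fun n i x => 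
    m * bbmpS (δ n) ((‖x‖ ^ 2 - z0) / (‖x‖ ^ 2 + δ n)) * x i
  let f : ℕ → EuclideanSpace ℝ (Fin 2) → ℝ := fun n x => 
    fderiv ℝ (P n 0) x (EuclideanSpace.single 0 1) + fderiv ℝ (P n 1) x (EuclideanSpace.single 1 1)
  have hP : ∀ n i, ContDiff ℝ 1 (P n i) := fun n i => (bbmp_field (δ n) m z0 (hδ n) i).1
  have hnorm : ∀ x : EuclideanSpace ℝ (Fin 2), x 0 ^ 2 + x 1 ^ 2 = ‖x‖ ^ 2 := by
    intro x
    rw [EuclideanSpace.norm_sq_eq]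
    simp
  have hf : ∀ n x, f n x = 2 * m * bbmpS (δ n) ((‖x‖ ^ 2 - z0) / (‖x‖ ^ 2 + δ n)) + 
      2 * m * ((max ((‖x‖ ^ 2 - z0) / (‖x‖ ^ 2 + δ n)) 0 - 
        max ((‖x‖ ^ 2 - z0) / (‖x‖ ^ 2 + δ n) - δ n) 0) / δ n) *
        ((z0 + δ n) / (‖x‖ ^ 2 + δ n) ^ 2) * ‖x‖ ^ 2 := by
    intro n x
    simp only [f, P]
    rw [(bbmp_field (δ n) m z0 (hδ n) 0).2, (bbmp_field (δ n) m z0 (hδ n) 1).2, ← hnorm]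
    ring
  apply bbmp_fatou Ω hopen hbdd f _ _ _ _ _ (hopen.measurableSet.diff isClosed_closedBall.measurableSet)
    Set.sdiff_subset _ (by positivity)
  · rintro x ⟨-, hx⟩
    have hx' : z0 < ‖x‖ ^ 2 := by
      rw [mem_closedBall, dist_zero_right, not_le] at hx
      calc z0 = √z0 ^ 2 := (Real.sq_sqrt hz0).symm
        _ < ‖x‖ ^ 2 := by gcongr
    set ρ := ‖x‖ ^ 2 with hρ
    have hρ0 : 0 < ρ := by linarith
    have hv : Filter.Tendsto (fun n => (ρ - z0) / (ρ + δ n)) Filter.atTop (nhds ((ρ - z0) / (ρ + 0))) :=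
      tendsto_const_nhds.div (tendsto_const_nhds.add hδ0) (by linarith)
    refine ⟨fun n => 2 * m * ((ρ - z0) / (ρ + δ n) - δ n / 2 + (z0 + δ n) / (ρ + δ n) ^ 2 * ρ), ?_, ?_⟩
    · have : Filter.Tendsto (fun n => 2 * m * ((ρ - z0) / (ρ + δ n) - δ n / 2 + (z0 + δ n) / (ρ + δ n) ^ 2 * ρ)) 
          Filter.atTop (nhds (2 * m * ((ρ - z0) / (ρ + 0) - 0 / 2 + (z0 + 0) / (ρ + 0) ^ 2 * ρ))) := by
        apply Filter.Tendsto.const_mul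
        apply (hv.sub (hδ0.div_const 2)).add
        apply Filter.Tendsto.mul_const
        exact (tendsto_const_nhds.add hδ0).div ((tendsto_const_nhds.add hδ0).pow 2) (by positivity)
      have e : 2 * m * ((ρ - z0) / (ρ + 0) - 0 / 2 + (z0 + 0) / (ρ + 0) ^ 2 * ρ) = 2 * m := by
        simp only [add_zero]
        field_simp
        ring
      rwa [e] at this
    · have hpos : 0 < (ρ - z0) / (ρ + 0) := by
        rw [add_zero]
        exact div_pos (by linarith) hρ0
      filter_upwards [hδ0.eventually_lt hv hpos] with n hn
      have hn0 := hδ n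
      rw [hf, ← hρ]
      unfold bbmpS
      rw [max_eq_left (by linarith : 0 ≤ (ρ - z0) / (ρ + δ n)), 
        max_eq_left (by linarith : 0 ≤ (ρ - z0) / (ρ + δ n) - δ n)]
      apply le_of_eq
      generalize (ρ - z0) / (ρ + δ n) = v
      generalize (z0 + δ n) / (ρ + δ n) ^ 2 = w
      field_simp
      ring
  · intro n
    exact (bbmp_cfd (hP n 0) _).add (bbmp_cfd (hP n 1) _)
  · intro n x
    have hn0 := hδ n
    rw [hf]
    have h1 := bbmpS_nonneg (δ n) ((‖x‖ ^ 2 - z0) / (‖x‖ ^ 2 + δ n)) hn0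
    have h2 : 0 ≤ max ((‖x‖ ^ 2 - z0) / (‖x‖ ^ 2 + δ n)) 0 - 
        max ((‖x‖ ^ 2 - z0) / (‖x‖ ^ 2 + δ n) - δ n) 0 := 
      sub_nonneg.2 (max_le_max (by linarith) le_rfl)
    positivity
  · intro n
    have hn0 := hδ n
    have hMc : Continuous fun x : EuclideanSpace ℝ (Fin 2) => 
        m * bbmpS (δ n) ((‖x‖ ^ 2 - z0) / (‖x‖ ^ 2 + δ n)) * ‖x‖ := by
      have := (bbmpS_contDiff (δ n) hn0).continuous
      have : ∀ y : EuclideanSpace ℝ (Fin 2), (‖y‖ ^ 2 + δ n) ≠ 0 := fun y => by positivity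
      fun_prop (disch := assumption)
    have hS := fun x : EuclideanSpace ℝ (Fin 2) => 
      bbmpS_nonneg (δ n) ((‖x‖ ^ 2 - z0) / (‖x‖ ^ 2 + δ n)) hn0
    refine (bbmp_div Ω hopen hbdd hH (P n 0) (P n 1) _ (hP n 0) (hP n 1) hMc 
      (fun x => by have := hS x; positivity) ?_).trans ?_
    · intro x
      apply le_of_eq
      simp only [P]
      linear_combination (m * bbmpS (δ n) ((‖x‖ ^ 2 - z0) / (‖x‖ ^ 2 + δ n))) ^ 2 * hnorm x
    · apply integral_mono (bbmp_integrable_frontier hbdd hH hMc) hbi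
      intro x
      simp only
      have ht : 0 ≤ ‖x‖ := norm_nonneg x
      generalize ‖x‖ = t at ht
      have h1 := bbmpS_le (δ n) ((t ^ 2 - z0) / (t ^ 2 + δ n)) hn0
      rcases le_total (t ^ 2 - z0) 0 with h | h
      · rw [max_eq_right (div_nonpos_of_nonpos_of_nonneg h (by positivity))] at h1
        have : m * bbmpS (δ n) ((t ^ 2 - z0) / (t ^ 2 + δ n)) * t ≤ 0 := by
          have : 0 ≤ m * t := by positivity
          nlinarith
        linarith [hb0 t ht]
      · rw [max_eq_left (div_nonneg h (by positivity))] at h1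
        calc m * bbmpS (δ n) ((t ^ 2 - z0) / (t ^ 2 + δ n)) * t 
            ≤ m * ((t ^ 2 - z0) / (t ^ 2 + δ n)) * t := by gcongr
          _ = (m * (t ^ 2 - z0)) * t / (t ^ 2 + δ n) := by ring
          _ ≤ (b t * t) * t / (t ^ 2 + δ n) := by
            have := hb t ht
            gcongr ?_ * t / _
          _ ≤ b t := by
            rw [div_le_iff₀ (by positivity)]
            nlinarith [hb0 t ht]

lemma bbmp_finite (Ω : Set (EuclideanSpace ℝ (Fin 2))) (h : HasLipschitzBoundary Ω) :
    μH[1] (frontier Ω) ≠ ⊤ := by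
  obtain ⟨n, γ, K, hK, he⟩ := h
  rw [he, ← lt_top_iff_ne_top]
  refine (measure_iUnion_le _).trans_lt ?_
  rw [tsum_fintype, ENNReal.sum_lt_top]
  intro i _
  refine ((hK i).hausdorffMeasure_image_le zero_le_one _).trans_lt ?_
  rw [hausdorffMeasure_real]
  simp

lemma bbmp_sphere_le (R : ℝ) (hR : 0 < R) :
    μH[1] (sphere (0 : EuclideanSpace ℝ (Fin 2)) R) ≤ ENNReal.ofReal (2 * π * R) := by
  let γ : ℝ → EuclideanSpace ℝ (Fin 2) := fun t => !₂[R * cos t, R * sin t]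
  have hl : LipschitzWith (Real.toNNReal R) γ := by
    apply LipschitzWith.of_dist_le_mul
    intro t s
    rw [Real.coe_toNNReal R hR.le, EuclideanSpace.dist_eq, Real.dist_eq]
    apply Real.sqrt_le_iff.2 ⟨by positivity, ?_⟩
    simp only [γ, Fin.sum_univ_two, Real.dist_eq, sq_abs, mul_pow]
    simp
    have h1 := Real.one_sub_sq_div_two_le_cos (x := t - s)
    rw [cos_sub] at h1
    have h2 := sin_sq_add_cos_sq t
    have h3 := sin_sq_add_cos_sq s
    have h4 : (cos t - cos s) ^ 2 + (sin t - sin s) ^ 2 ≤ (t - s) ^ 2 := by nlinarith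
    calc (R * cos t - R * cos s) ^ 2 + (R * sin t - R * sin s) ^ 2 
        = R ^ 2 * ((cos t - cos s) ^ 2 + (sin t - sin s) ^ 2) := by ring
      _ ≤ R ^ 2 * (t - s) ^ 2 := by gcongr
  have hsub : sphere (0 : EuclideanSpace ℝ (Fin 2)) R ⊆ γ '' Set.Icc (-π) π := by
    intro x hx
    have hx' : ‖x‖ = R := by simpa using hx
    let w : ℂ := ⟨x 0, x 1⟩
    have hw : ‖w‖ = R := by
      rw [← hx', EuclideanSpace.norm_eq, Complex.norm_def, Complex.normSq_apply]
      simp [Fin.sum_univ_two, w, sq]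
    refine ⟨w.arg, ⟨(Complex.neg_pi_lt_arg w).le, Complex.arg_le_pi w⟩, ?_⟩
    have c1 := Complex.norm_mul_cos_arg w
    have c2 := Complex.norm_mul_sin_arg w
    rw [hw] at c1 c2
    ext i
    fin_cases i
    · simpa [γ] using c1
    · simpa [γ] using c2
  calc μH[1] (sphere (0 : EuclideanSpace ℝ (Fin 2)) R) ≤ μH[1] (γ '' Set.Icc (-π) π) := measure_mono hsub
    _ ≤ _ := hl.hausdorffMeasure_image_le zero_le_one _
    _ = ENNReal.ofReal (2 * π * R) := by
      rw [hausdorffMeasure_real, Real.volume_Icc, ENNReal.rpow_one]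
      rw [← ENNReal.ofReal, ← ENNReal.ofReal_mul hR.le]
      congr 1
      ring

lemma bbmp_sphere (R : ℝ) (hR : 0 < R) :
    (μH[1] (sphere (0 : EuclideanSpace ℝ (Fin 2)) R)).toReal = 2 * π * R := by
  have h1 := bbmp_sphere_le R hR
  have hne : μH[1] (sphere (0 : EuclideanSpace ℝ (Fin 2)) R) ≠ ⊤ := ne_top_of_le_ne_top ENNReal.ofReal_ne_top h1
  apply le_antisymm
  · exact ENNReal.toReal_le_of_le_ofReal (by positivity) h1
  · have := bbmp_isop (ball 0 R) isOpen_ball isBounded_ball 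
      (by rwa [frontier_ball _ hR.ne']) R hR (bbmp_volball 0 R hR.le)
    rwa [frontier_ball _ hR.ne'] at this

lemma bbmp_subgrad (g : ℝ → ℝ) (hg : ConvexOn ℝ (Set.Ici 0) g) (c : ℝ) (hc : 0 < c) :
    ∃ m, ∀ z, 0 ≤ z → g c + m * (z - c) ≤ g z := by
  have hi : c ∈ interior (Set.Ici (0 : ℝ)) := by simpa using hc
  refine ⟨derivWithin g (Set.Ioi c) c, fun z hz => ?_⟩
  rcases lt_trichotomy z c with h | h | h
  · have h1 := hg.slope_le_leftDeriv_of_mem_interior (show z ∈ Set.Ici (0 : ℝ) from hz) hi h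
    have h2 := hg.leftDeriv_le_rightDeriv_of_mem_interior hi
    have h3 := h1.trans h2
    rw [slope_def_field, div_le_iff₀ (by linarith)] at h3
    linarith
  · subst h
    simp
  · have h1 := hg.rightDeriv_le_slope_of_mem_interior hi (show z ∈ Set.Ici (0 : ℝ) from hz) h
    rw [slope_def_field, le_div_iff₀ (by linarith)] at h1
    linarith

lemma bbmp_aint (Ω : Set (EuclideanSpace ℝ (Fin 2))) 
    (hbdd : Bornology.IsBounded Ω) (hH : μH[1] (frontier Ω) ≠ ⊤) (a : ℝ → ℝ)
    (ha_nonneg : ∀ z, 0 ≤ z → 0 ≤ a z)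
    (ha_mono : MonotoneOn a (Set.Ici 0)) :
    IntegrableOn (fun x => a ‖x‖) (frontier Ω) μH[1] := by
  have hm : Monotone fun t : ℝ => a (max t 0) := fun s t hst => 
    ha_mono (le_max_right s 0) (le_max_right t 0) (max_le_max hst le_rfl)
  have hmeas : Measurable fun x : EuclideanSpace ℝ (Fin 2) => a ‖x‖ := by
    have := hm.measurable.comp (measurable_norm (α := EuclideanSpace ℝ (Fin 2)))
    convert this using 2 with x
    simp
  obtain ⟨C, hC⟩ := (hbdd.closure.subset frontier_subset_closure).exists_norm_le
  apply Measure.integrableOn_of_bounded hH hmeas.aestronglyMeasurable (M := a C)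
  filter_upwards [ae_restrict_mem isClosed_frontier.measurableSet] with x hx
  rw [Real.norm_eq_abs, abs_of_nonneg (ha_nonneg _ (norm_nonneg x))]
  exact ha_mono (norm_nonneg x) ((norm_nonneg x).trans (hC x hx)) (hC x hx)

/-- Theorem of Betta–Brock–Mercaldo–Posteraro: for a nondecreasing weight
`a : [0,∞) → [0,∞)` such that `z ↦ (a(√z) - a(0))·√z` is convex, the weighted
perimeter of any bounded open set `Ω` with Lipschitz boundary is at least that of
the centered disc `B_R(0)` of the same area, which equals `2πR·a(R)`. -/
theorem betta_brock_mercaldo_posteraro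
    (Ω : Set (EuclideanSpace ℝ (Fin 2)))
    (hopen : IsOpen Ω) (hbdd : Bornology.IsBounded Ω)
    (hbry : HasLipschitzBoundary Ω)
    (R : ℝ) (hR : 0 < R) (hvol : (volume Ω).toReal = π * R ^ 2)
    (a : ℝ → ℝ)
    (ha_nonneg : ∀ z, 0 ≤ z → 0 ≤ a z)
    (ha_mono : MonotoneOn a (Set.Ici 0))
    (ha_conv : ConvexOn ℝ (Set.Ici 0) fun z => (a (Real.sqrt z) - a 0) * Real.sqrt z) :
    (∫ x in frontier (ball (0 : EuclideanSpace ℝ (Fin 2)) R), a ‖x‖ ∂μH[1])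
        = 2 * π * R * a R ∧
      2 * π * R * a R ≤ ∫ x in frontier Ω, a ‖x‖ ∂μH[1] := by
  constructor
  · rw [frontier_ball _ hR.ne', setIntegral_congr_fun (g := fun _ => a R) isClosed_sphere.measurableSet]
    · simp [Measure.real, bbmp_sphere R hR]
    · intro x hx
      have : ‖x‖ = R := by simpa using hx
      simp [this]
  have hH := bbmp_finite Ω hbry
  have hai := bbmp_aint Ω hbdd hH a ha_nonneg ha_mono
  have hL := bbmp_isop Ω hopen hbdd hH R hR hvol
  set L := (μH[1] (frontier Ω)).toReal with hLdef
  have hci : IntegrableOn (fun _ => a 0) (frontier Ω) (μH[1] : Measure (EuclideanSpace ℝ (Fin 2))) := 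
    bbmp_integrable_frontier hbdd hH continuous_const
  have hb0 : ∀ t, 0 ≤ t → 0 ≤ a t - a 0 := fun t ht => 
    sub_nonneg.2 (ha_mono (Set.self_mem_Ici) ht ht)
  have hbi : IntegrableOn (fun x : EuclideanSpace ℝ (Fin 2) => a ‖x‖ - a 0) (frontier Ω) μH[1] := hai.sub hci
  have hsplit : ∫ x in frontier Ω, (a ‖x‖ - a 0) ∂μH[1] = ∫ x in frontier Ω, a ‖x‖ ∂μH[1] - L * a 0 := by
    rw [integral_sub hai hci]
    simp [Measure.real, hLdef]
  have ha0 := ha_nonneg 0 le_rfl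
  have key : 2 * π * R * (a R - a 0) ≤ ∫ x in frontier Ω, (a ‖x‖ - a 0) ∂μH[1] := by
    obtain ⟨m, hm⟩ := bbmp_subgrad _ ha_conv (R ^ 2) (by positivity)
    simp only [Real.sqrt_sq hR.le] at hm
    have hm0 := hm 0 le_rfl
    simp at hm0
    have hbR := hb0 R hR.le
    have hgR : 0 ≤ (a R - a 0) * R := by positivity
    by_cases hmp : 0 < m
    · set z0 := R ^ 2 - (a R - a 0) * R / m with hz0
      have hz : m * (R ^ 2 - z0) = (a R - a 0) * R := by
        rw [hz0]
        field_simp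
        ring
      have hz0' : 0 ≤ z0 := by
        rw [hz0, sub_nonneg, div_le_iff₀ hmp]
        linarith
      have hp := bbmp_part2 Ω hopen hbdd hH (fun t => a t - a 0) m z0 hmp hz0' hb0 (by
        intro t ht
        have := hm (t ^ 2) (by positivity)
        rw [Real.sqrt_sq ht] at this
        linarith) hbi
      refine le_trans ?_ hp
      have hv : π * R ^ 2 - π * z0 ≤ (volume (Ω \ closedBall 0 √z0)).toReal := by
        have hB : (volume (closedBall (0 : EuclideanSpace ℝ (Fin 2)) √z0)).toReal = π * z0 := by
          rw [Measure.addHaar_closedBall_eq_addHaar_ball, bbmp_volball _ _ (Real.sqrt_nonneg _), Real.sq_sqrt hz0']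
        have hfin : volume (Ω \ closedBall 0 √z0) ≠ ⊤ := 
          (hbdd.subset Set.sdiff_subset).measure_lt_top.ne
        have hfin2 : volume (closedBall (0 : EuclideanSpace ℝ (Fin 2)) √z0) ≠ ⊤ := 
          isBounded_closedBall.measure_lt_top.ne
        have h1 : volume Ω ≤ volume (Ω \ closedBall 0 √z0) + volume (closedBall (0 : EuclideanSpace ℝ (Fin 2)) √z0) := by
          refine (measure_mono ?_).trans (measure_union_le _ _)
          intro x hx
          by_cases h : x ∈ closedBall (0 : EuclideanSpace ℝ (Fin 2)) √z0
          · exact Or.inr h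
          · exact Or.inl ⟨hx, h⟩
        have h2 := ENNReal.toReal_mono (ENNReal.add_ne_top.2 ⟨hfin, hfin2⟩) h1
        rw [ENNReal.toReal_add hfin hfin2, hvol, hB] at h2
        linarith
      calc 2 * π * R * (a R - a 0) = 2 * m * (π * R ^ 2 - π * z0) := by
            linear_combination (-2) * π * hz
        _ ≤ _ := by gcongr
    · have : (a R - a 0) = 0 := by
        have h1 : m * R ^ 2 ≤ 0 := mul_nonpos_of_nonpos_of_nonneg (not_lt.1 hmp) (by positivity)
        have h2 : (a R - a 0) * R = 0 := by linarith
        rcases mul_eq_zero.1 h2 with h | h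
        · exact h
        · exact absurd h hR.ne'
      rw [this, mul_zero]
      exact integral_nonneg fun x => hb0 _ (norm_nonneg x)
  rw [hsplit] at key
  nlinarith [mul_le_mul_of_nonneg_right hL ha0]
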